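/- arXiv:2402.07043 — 3 statements merged into one kernel-verified Lean document; each statement's English description precedes it below -/
import Mathlib

section
/- Let β > 1 and c := 1 − 1/β, and let p be the Zipf distribution with exponent β on the positive integers, p_i = i^{-β}/ζ(β). Then there exist constants C₁, C₂ > 0 and T₀ ≥ 1, depending only on β, such that for every integer T ≥ T₀ one has C₁·T^{-c} ≤ Σ_{i=1}^∞ p_i (1 − p_i)^T ≤ C₂·T^{-c}. (This quantity is the expected test error of the infinite-memory Hutter model trained on T iid samples from p: the probability that a fresh sample i ~ p did not occur among the T training samples.) -/
/-- The Zipf distribution with exponent `β` on the positive integers: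
`p i = i^(-β) / ζ(β)`, where the normalization is `ζ(β) = ∑_{j ≥ 1} j^(-β)`.
(Note `(0:ℝ)^(-β) = 0`, so `zipf β 0 = 0` and sums over `ℕ` effectively range
over the positive integers.) -/
noncomputable def zipf (β : ℝ) (i : ℕ) : ℝ :=
  (i : ℝ) ^ (-β) / ∑' j : ℕ, ((j : ℝ) + 1) ^ (-β)

lemma zipf_aux_step (β : ℝ) (hβ : 1 < β) (x : ℝ) (hx : 0 < x) :
    (x + 1) ^ (-β) ≤ (x ^ (1 - β) - (x + 1) ^ (1 - β)) / (β - 1) := by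
  have hx1 : 0 < x + 1 := by linarith
  have hb : 0 < β - 1 := by linarith
  have h1 : (x + 1) ^ (1 - β) = (x + 1) ^ (-β) * (x + 1) := by
    rw [show (1 - β) = -β + 1 by ring, Real.rpow_add hx1, Real.rpow_one]
  have h2 : x ^ (1 - β) = (x + 1) ^ (1 - β) * (x / (x + 1)) ^ (1 - β) := by
    rw [← Real.mul_rpow hx1.le (by positivity)]
    congr 1
    field_simp
  have hq : 0 < x / (x + 1) := by positivity
  have h3 : 1 + (β - 1) / (x + 1) ≤ (x / (x + 1)) ^ (1 - β) := by
    rw [Real.rpow_def_of_pos hq]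
    have e := Real.add_one_le_exp (Real.log (x / (x + 1)) * (1 - β))
    have l := Real.log_le_sub_one_of_pos hq
    have l2 : x / (x + 1) - 1 = - (1 / (x + 1)) := by field_simp; ring
    rw [l2] at l
    have : (β - 1) / (x + 1) = (1 / (x + 1)) * (β - 1) := by ring
    rw [this]
    nlinarith
  have hp : 0 < (x + 1) ^ (-β) := Real.rpow_pos_of_pos hx1 _
  rw [le_div_iff₀ hb, h2, h1]
  have h4 : (x + 1) ^ (-β) * (x + 1) * (1 + (β - 1) / (x + 1)) ≤
      (x + 1) ^ (-β) * (x + 1) * (x / (x + 1)) ^ (1 - β) := by gcongr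
  have h5 : (x + 1) ^ (-β) * (x + 1) * (1 + (β - 1) / (x + 1)) =
      (x + 1) ^ (-β) * (x + 1) + (x + 1) ^ (-β) * (β - 1) := by
    field_simp
  linarith

lemma zipf_aux_tail (β : ℝ) (hβ : 1 < β) (N : ℕ) (hN : 1 ≤ N) (n : ℕ) :
    ∑ i ∈ Finset.range n, ((i + (N + 1) : ℕ) : ℝ) ^ (-β) ≤ (N : ℝ) ^ (1 - β) / (β - 1) := by
  have hb : 0 < β - 1 := by linarith
  have key : ∑ i ∈ Finset.range n, ((i + (N + 1) : ℕ) : ℝ) ^ (-β) ≤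
      (N : ℝ) ^ (1 - β) / (β - 1) - ((n + N : ℕ) : ℝ) ^ (1 - β) / (β - 1) := by
    induction n with
    | zero => simp
    | succ k ih =>
      rw [Finset.sum_range_succ]
      have hpos : (0 : ℝ) < ((k + N : ℕ) : ℝ) := by exact_mod_cast (by omega : 0 < k + N)
      have s := zipf_aux_step β hβ ((k + N : ℕ) : ℝ) hpos
      have e1 : ((k + (N + 1) : ℕ) : ℝ) = ((k + N : ℕ) : ℝ) + 1 := by push_cast; ring
      have e2 : ((k + 1 + N : ℕ) : ℝ) = ((k + N : ℕ) : ℝ) + 1 := by push_cast; ring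
      rw [e1, e2]
      rw [sub_div] at s
      linarith
  have : 0 ≤ ((n + N : ℕ) : ℝ) ^ (1 - β) / (β - 1) := by positivity
  linarith

/-- For `β > 1` and `c = 1 - 1/β`, the expected test error of the
infinite-memory Hutter model trained on `T` iid samples from the Zipf distribution `p`,
namely `∑_i p_i (1 - p_i)^T`, is of order `T^(-c)` for all large `T`. -/
theorem hutter_clean_scaling (β : ℝ) (hβ : 1 < β) (c : ℝ) (hc : c = 1 - 1 / β) :
    ∃ C₁ C₂ : ℝ, 0 < C₁ ∧ 0 < C₂ ∧ ∃ T₀ : ℕ, 1 ≤ T₀ ∧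
      ∀ T : ℕ, T₀ ≤ T →
        C₁ * (T : ℝ) ^ (-c) ≤ (∑' i : ℕ, zipf β i * (1 - zipf β i) ^ T) ∧
        (∑' i : ℕ, zipf β i * (1 - zipf β i) ^ T) ≤ C₂ * (T : ℝ) ^ (-c) := by
  have hb : 0 < β - 1 := by linarith
  have hb0 : 0 < β := by linarith
  have hS : Summable (fun i : ℕ => (i : ℝ) ^ (-β)) := Real.summable_nat_rpow.2 (by linarith)
  have hS1 : Summable (fun j : ℕ => ((j : ℝ) + 1) ^ (-β)) := by
    have := (summable_nat_add_iff 1).2 hS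
    simpa using this
  obtain ⟨Z, hZ⟩ : ∃ Z : ℝ, Z = ∑' j : ℕ, ((j : ℝ) + 1) ^ (-β) := ⟨_, rfl⟩
  have hZ1 : 1 ≤ Z := by
    have := hS1.le_tsum 0 (fun j _ => by positivity)
    rw [hZ]; simpa using this
  have hZ0 : 0 < Z := by linarith
  have hz : ∀ i : ℕ, zipf β i = (i : ℝ) ^ (-β) / Z := fun i => by rw [zipf, hZ]
  have hle : ∀ i : ℕ, zipf β i ≤ (i : ℝ) ^ (-β) := fun i => by
    rw [hz]; exact div_le_self (by positivity) hZ1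
  have hnn : ∀ i : ℕ, 0 ≤ zipf β i := fun i => by rw [hz]; positivity
  have hone : ∀ i : ℕ, zipf β i ≤ 1 := fun i => by
    refine (hle i).trans ?_
    rcases Nat.eq_zero_or_pos i with rfl | hi
    · rw [Nat.cast_zero, Real.zero_rpow (by linarith)]; norm_num
    · exact Real.rpow_le_one_of_one_le_of_nonpos (by exact_mod_cast hi) (by linarith)
  refine ⟨(4:ℝ) ^ (-β) / Z * 2 ^ (1 - β), 4 + 1 / (β - 1), by positivity, by positivity,
    1, le_rfl, ?_⟩
  intro T hT
  have hT1 : (1 : ℝ) ≤ T := by exact_mod_cast hT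
  have hT0 : (0 : ℝ) < T := by linarith
  have hf0 : ∀ i : ℕ, 0 ≤ zipf β i * (1 - zipf β i) ^ T := fun i =>
    mul_nonneg (hnn i) (pow_nonneg (by linarith [hone i]) _)
  have hfle : ∀ i : ℕ, zipf β i * (1 - zipf β i) ^ T ≤ (i : ℝ) ^ (-β) := fun i => by
    refine le_trans ?_ (hle i)
    exact mul_le_of_le_one_right (hnn i)
      (pow_le_one₀ (by linarith [hone i]) (by linarith [hnn i]))
  have hfS : Summable (fun i : ℕ => zipf β i * (1 - zipf β i) ^ T) :=
    Summable.of_nonneg_of_le hf0 hfle hS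
  obtain ⟨R, hR⟩ : ∃ R : ℝ, R = (T : ℝ) ^ (1 / β) := ⟨_, rfl⟩
  have hR1 : 1 ≤ R := by rw [hR]; exact Real.one_le_rpow hT1 (by positivity)
  have hR0 : 0 < R := by linarith
  have hRb : R ^ (-β) = 1 / T := by
    rw [hR, ← Real.rpow_mul hT0.le, show 1 / β * -β = -1 by field_simp, Real.rpow_neg_one,
      one_div]
  have hRc : R ^ (1 - β) = (T : ℝ) ^ (-c) := by
    rw [hR, ← Real.rpow_mul hT0.le]; congr 1; rw [hc]; field_simp; ring
  have hRT : R / T = (T : ℝ) ^ (-c) := by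
    rw [← hRc, show (1 - β) = -β + 1 by ring, Real.rpow_add hR0, hRb, Real.rpow_one]; ring
  obtain ⟨N, hN⟩ : ∃ N : ℕ, N = ⌈R⌉₊ := ⟨_, rfl⟩
  have hRN : R ≤ N := by rw [hN]; exact Nat.le_ceil R
  have hN1 : 1 ≤ N := by
    have : (1 : ℝ) ≤ N := hR1.trans hRN
    exact_mod_cast this
  have hN1' : (1 : ℝ) ≤ N := by exact_mod_cast hN1
  have hN0 : (0 : ℝ) < N := by linarith
  have hN2 : (N : ℝ) ≤ 2 * R := by
    have := Nat.ceil_lt_add_one hR0.le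
    rw [← hN] at this
    linarith
  constructor
  · -- lower bound
    have hterm : ∀ i ∈ Finset.Ico (2 * N) (4 * N),
        (4 * N : ℝ) ^ (-β) / Z / 2 ≤ zipf β i * (1 - zipf β i) ^ T := by
      intro i hi
      rw [Finset.mem_Ico] at hi
      have hi1 : (2 * N : ℝ) ≤ i := by exact_mod_cast hi.1
      have hi2 : (i : ℝ) ≤ 4 * N := by exact_mod_cast hi.2.le
      have hi0 : (0 : ℝ) < i := by linarith
      have hlo : (4 * N : ℝ) ^ (-β) / Z ≤ zipf β i := by
        rw [hz]
        exact div_le_div_of_nonneg_right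
          (Real.rpow_le_rpow_of_nonpos hi0 hi2 (by linarith)) hZ0.le
      have hup : zipf β i ≤ 1 / 2 * (1 / T) := by
        calc zipf β i ≤ (i : ℝ) ^ (-β) := hle i
          _ ≤ (2 * R) ^ (-β) :=
            Real.rpow_le_rpow_of_nonpos (by positivity) (by linarith) (by linarith)
          _ = 2 ^ (-β) * (1 / T) := by rw [Real.mul_rpow (by norm_num) hR0.le, hRb]
          _ ≤ 1 / 2 * (1 / T) := by
            gcongr
            calc (2 : ℝ) ^ (-β) ≤ 2 ^ (-1 : ℝ) :=
                  Real.rpow_le_rpow_of_exponent_le (by norm_num) (by linarith)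
              _ = 1 / 2 := by rw [Real.rpow_neg_one]; norm_num
      have hber : 1 / 2 ≤ (1 - zipf β i) ^ T := by
        have h := one_add_mul_le_pow (a := - zipf β i) (by linarith [hone i]) T
        have h2 : (T : ℝ) * zipf β i ≤ 1 / 2 := by
          calc (T : ℝ) * zipf β i ≤ T * (1 / 2 * (1 / T)) := by gcongr
            _ = 1 / 2 := by field_simp
        rw [← sub_eq_add_neg] at h
        linarith
      calc (4 * N : ℝ) ^ (-β) / Z / 2 = (4 * N : ℝ) ^ (-β) / Z * (1 / 2) := by ring
        _ ≤ _ := mul_le_mul hlo hber (by norm_num) (hnn i)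
    have h1 := Finset.card_nsmul_le_sum _ _ _ hterm
    have h2 := hfS.sum_le_tsum (Finset.Ico (2 * N) (4 * N)) (fun i _ => hf0 i)
    refine le_trans ?_ (h1.trans h2)
    rw [Nat.card_Ico, show 4 * N - 2 * N = 2 * N by omega, nsmul_eq_mul,
      Real.mul_rpow (by norm_num) hN0.le]
    have h3 : (N : ℝ) ^ (1 - β) = N ^ (-β) * N := by
      rw [show (1 - β) = -β + 1 by ring, Real.rpow_add hN0, Real.rpow_one]
    have h4 : (2 * R) ^ (1 - β) ≤ (N : ℝ) ^ (1 - β) :=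
      Real.rpow_le_rpow_of_nonpos hN0 hN2 (by linarith)
    rw [Real.mul_rpow (by norm_num) hR0.le, hRc, h3] at h4
    calc (4:ℝ) ^ (-β) / Z * 2 ^ (1 - β) * (T : ℝ) ^ (-c)
        = (4:ℝ) ^ (-β) / Z * (2 ^ (1 - β) * (T : ℝ) ^ (-c)) := by ring
      _ ≤ (4:ℝ) ^ (-β) / Z * (N ^ (-β) * N) := by gcongr
      _ = _ := by push_cast; ring
  · -- upper bound
    rw [← hfS.sum_add_tsum_nat_add (N + 1)]
    have hA : ∑ i ∈ Finset.range (N + 1), zipf β i * (1 - zipf β i) ^ T ≤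
        4 * (T : ℝ) ^ (-c) := by
      have hterm : ∀ i ∈ Finset.range (N + 1),
          zipf β i * (1 - zipf β i) ^ T ≤ 1 / T := by
        intro i _
        have hp := hnn i
        have hp1 := hone i
        have h := one_add_mul_le_pow (a := zipf β i) (by linarith) T
        have hq : 0 ≤ (1 - zipf β i) ^ T := pow_nonneg (by linarith) _
        have hm : (1 - zipf β i) ^ T * (1 + zipf β i) ^ T ≤ 1 := by
          rw [← mul_pow]
          exact pow_le_one₀ (mul_nonneg (by linarith) (by linarith)) (by nlinarith)
        have hm2 := mul_le_mul_of_nonneg_left h hq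
        rw [le_div_iff₀ hT0]
        nlinarith
      have h1 := Finset.sum_le_card_nsmul _ _ _ hterm
      rw [Finset.card_range, nsmul_eq_mul] at h1
      refine h1.trans ?_
      rw [← hRT]
      calc ((N + 1 : ℕ) : ℝ) * (1 / T) ≤ (4 * R) * (1 / T) := by
            gcongr; push_cast; linarith
        _ = _ := by ring
    have hB : ∑' i : ℕ, zipf β (i + (N + 1)) * (1 - zipf β (i + (N + 1))) ^ T ≤
        1 / (β - 1) * (T : ℝ) ^ (-c) := by
      refine Real.tsum_le_of_sum_range_le (fun i => hf0 _) (fun n => ?_)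
      refine (Finset.sum_le_sum (fun i _ => hfle (i + (N + 1)))).trans ?_
      refine (zipf_aux_tail β hβ N hN1 n).trans ?_
      rw [← hRc, one_div_mul_eq_div]
      gcongr ?_ / _
      exact Real.rpow_le_rpow_of_nonpos hR0 hRN (by linarith)
    linarith
end

section
/- Let β > 1, c := 1 − 1/β, and let p be the Zipf distribution with exponent β on the positive integers, p_i = i^{-β}/ζ(β). Define the test error of the Hutter model trained on T iid samples from the version of p whose tail is chopped off at rank k as E(T,k) := Σ_{i ≥ k+1} p_i + Σ_{i=1}^{k} p_i (1 − p_i)^T. Then there exist constants C₁, C₂ > 0 and thresholds T₀, k₀, depending only on β, such that for all integers T ≥ T₀ and k ≥ k₀: C₁·(T^{-c} + k^{-(β-1)}) ≤ E(T,k) ≤ C₂·(T^{-c} + k^{-(β-1)}); equivalently, E(T,k) is bounded above and below by constant multiples of min(T, k^β)^{-c}. In particular, as soon as T ≳ k^β the error plateaus at the level k^{-(β-1)}. -/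
/-- Test error of the Hutter model trained on `T` iid samples from the Zipf distribution
with its tail chopped off at rank `k`:
`E(T,k) = ∑_{i ≥ k+1} p_i + ∑_{i=1}^k p_i (1-p_i)^T`. -/
noncomputable def EtestTail (β : ℝ) (T k : ℕ) : ℝ :=
  (∑' i : ℕ, if k + 1 ≤ i then zipf β i else 0) +
    ∑ i ∈ Finset.Icc 1 k, zipf β i * (1 - zipf β i) ^ T

section Aux
open Finset

lemma zs_summable (β : ℝ) (hβ : 1 < β) : Summable (fun j : ℕ => (j : ℝ) ^ (-β)) :=
  Real.summable_nat_rpow.2 (by linarith)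

lemma zs_summable' (β : ℝ) (hβ : 1 < β) : Summable (fun j : ℕ => ((j : ℝ) + 1) ^ (-β)) := by
  have := (summable_nat_add_iff 1).2 (zs_summable β hβ)
  simpa using this

lemma Z_ge_one (β : ℝ) (hβ : 1 < β) : 1 ≤ ∑' j : ℕ, ((j : ℝ) + 1) ^ (-β) := by
  have := (zs_summable' β hβ).le_tsum 0 (fun j _ => by positivity)
  simpa using this

lemma zipf_nonneg (β : ℝ) (hβ : 1 < β) (i : ℕ) : 0 ≤ zipf β i := by
  have := Z_ge_one β hβ
  unfold zipf; positivity

lemma zipf_zero (β : ℝ) (hβ : 1 < β) : zipf β 0 = 0 := by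
  unfold zipf
  rw [Nat.cast_zero, Real.zero_rpow (by linarith)]; simp

lemma zipf_le (β : ℝ) (hβ : 1 < β) (i : ℕ) : zipf β i ≤ (i : ℝ) ^ (-β) := by
  have := Z_ge_one β hβ
  unfold zipf
  exact div_le_self (by positivity) this

lemma zipf_le_one (β : ℝ) (hβ : 1 < β) (i : ℕ) : zipf β i ≤ 1 := by
  rcases Nat.eq_zero_or_pos i with rfl | h
  · rw [zipf_zero β hβ]; norm_num
  · refine (zipf_le β hβ i).trans ?_
    exact Real.rpow_le_one_of_one_le_of_nonpos (by exact_mod_cast h) (by linarith)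

lemma zipf_summable (β : ℝ) (hβ : 1 < β) : Summable (zipf β) := by
  unfold zipf
  exact (zs_summable β hβ).div_const _

lemma tail_summable (β : ℝ) (hβ : 1 < β) (k : ℕ) :
    Summable (fun i : ℕ => if k + 1 ≤ i then zipf β i else 0) := by
  refine Summable.of_nonneg_of_le (fun i => ?_) (fun i => ?_) (zipf_summable β hβ)
  · split_ifs
    · exact zipf_nonneg β hβ i
    · exact le_rfl
  · split_ifs
    · exact le_rfl
    · exact zipf_nonneg β hβ i

/-- Telescoping tangent-line inequality. -/
lemma tangent (β : ℝ) (hβ : 1 < β) (n : ℕ) (hn : 1 ≤ n) :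
    (β - 1) * ((n : ℝ) + 1) ^ (-β) ≤ (n : ℝ) ^ (1 - β) - ((n : ℝ) + 1) ^ (1 - β) := by
  have hn0 : (0 : ℝ) < n := by exact_mod_cast hn
  have hlog : Real.log ((n : ℝ) / (n + 1)) ≤ - (1 / ((n : ℝ) + 1)) := by
    have := Real.log_le_sub_one_of_pos (x := (n : ℝ) / (n + 1)) (by positivity)
    refine this.trans (le_of_eq ?_)
    field_simp; ring
  have h1 : 1 + (β - 1) * (1 / ((n : ℝ) + 1)) ≤ ((n : ℝ) / (n + 1)) ^ (1 - β) := by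
    rw [Real.rpow_def_of_pos (by positivity)]
    have := Real.add_one_le_exp (Real.log ((n : ℝ) / (n + 1)) * (1 - β))
    nlinarith
  rw [Real.div_rpow (by positivity) (by positivity), le_div_iff₀ (by positivity)] at h1
  have h2 : ((n : ℝ) + 1) ^ (1 - β) = ((n : ℝ) + 1) * ((n : ℝ) + 1) ^ (-β) := by
    rw [sub_eq_add_neg, Real.rpow_add (by positivity), Real.rpow_one]
  have h3 : (β - 1) * (1 / ((n : ℝ) + 1)) * ((n : ℝ) + 1) ^ (1 - β)
      = (β - 1) * ((n : ℝ) + 1) ^ (-β) := by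
    rw [h2]; field_simp
  nlinarith

lemma zipf_le_tel (β : ℝ) (hβ : 1 < β) (n : ℕ) (hn : 1 ≤ n) :
    zipf β (n + 1) ≤ ((n : ℝ) ^ (1 - β) - ((n : ℝ) + 1) ^ (1 - β)) / (β - 1) := by
  rw [le_div_iff₀ (by linarith)]
  have h := zipf_le β hβ (n + 1)
  push_cast at h
  have := tangent β hβ n hn
  nlinarith

lemma fin_tail (β : ℝ) (hβ : 1 < β) (n : ℕ) (hn : 1 ≤ n) (M : ℕ) :
    ∑ i ∈ range M, zipf β (n + i + 1) ≤
      ((n : ℝ) ^ (1 - β) - ((n + M : ℕ) : ℝ) ^ (1 - β)) / (β - 1) := by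
  induction M with
  | zero => simp
  | succ M ih =>
    rw [sum_range_succ]
    have := zipf_le_tel β hβ (n + M) (by omega)
    refine (add_le_add ih this).trans (le_of_eq ?_)
    push_cast
    rw [← add_assoc]; ring

lemma tail_le (β : ℝ) (hβ : 1 < β) (n : ℕ) (hn : 1 ≤ n) :
    (∑' i : ℕ, if n + 1 ≤ i then zipf β i else 0) ≤ (n : ℝ) ^ (1 - β) / (β - 1) := by
  have h := (tail_summable β hβ n).sum_add_tsum_nat_add (n + 1)
  have h0 : ∑ i ∈ range (n + 1), (if n + 1 ≤ i then zipf β i else 0) = 0 := by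
    apply sum_eq_zero
    intro i hi
    rw [mem_range] at hi
    rw [if_neg (by omega)]
  rw [h0, zero_add] at h
  rw [← h]
  refine Real.tsum_le_of_sum_range_le (fun i => ?_) (fun M => ?_)
  · split_ifs
    · exact zipf_nonneg β hβ _
    · exact le_rfl
  · have := fin_tail β hβ n hn M
    have e : ∑ i ∈ range M, (if n + 1 ≤ i + (n + 1) then zipf β (i + (n + 1)) else 0)
        = ∑ i ∈ range M, zipf β (n + i + 1) := by
      refine sum_congr rfl fun i _ => ?_
      rw [if_pos (by omega)]; congr 1; omega
    rw [e]
    refine this.trans ?_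
    have : 0 < β - 1 := by linarith
    gcongr
    have : (0 : ℝ) ≤ ((n + M : ℕ) : ℝ) ^ (1 - β) := by positivity
    linarith

lemma term_nonneg (β : ℝ) (hβ : 1 < β) (T i : ℕ) : 0 ≤ zipf β i * (1 - zipf β i) ^ T :=
  mul_nonneg (zipf_nonneg β hβ i) (pow_nonneg (by linarith [zipf_le_one β hβ i]) _)

lemma term_le (β : ℝ) (hβ : 1 < β) (T i : ℕ) : zipf β i * (1 - zipf β i) ^ T ≤ zipf β i :=
  mul_le_of_le_one_right (zipf_nonneg β hβ i)
    (pow_le_one₀ (by linarith [zipf_le_one β hβ i]) (by linarith [zipf_nonneg β hβ i]))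

lemma term_le_inv (β : ℝ) (hβ : 1 < β) (T i : ℕ) (hT : 1 ≤ T) :
    zipf β i * (1 - zipf β i) ^ T ≤ 1 / T := by
  have hT0 : (0 : ℝ) < T := by exact_mod_cast hT
  set p := zipf β i
  have hp := zipf_nonneg β hβ i
  have hp1 := zipf_le_one β hβ i
  have h1 : (1 - p) ^ T ≤ Real.exp (-(T * p)) := by
    have := pow_le_pow_left₀ (by linarith) (Real.one_sub_le_exp_neg p) T
    rw [← Real.exp_nat_mul] at this
    rwa [mul_neg] at this
  have h2 : T * p * Real.exp (-(T * p)) ≤ 1 := by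
    rw [Real.exp_neg, ← div_eq_mul_inv, div_le_one (Real.exp_pos _)]
    linarith [Real.add_one_le_exp (T * p)]
  rw [le_div_iff₀ hT0]
  have := mul_le_mul_of_nonneg_left h1 (mul_nonneg hT0.le hp)
  linarith

lemma E_upper (β : ℝ) (hβ : 1 < β) (T k n : ℕ) (hT : 1 ≤ T) (hk : 1 ≤ k) (hn : 1 ≤ n) :
    EtestTail β T k ≤ (k : ℝ) ^ (1 - β) / (β - 1) + (n : ℝ) ^ (1 - β) / (β - 1) + n / T := by
  have h1 := tail_le β hβ k hk
  have h2 := tail_le β hβ n hn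
  have h3 : ∑ i ∈ Icc 1 k, zipf β i * (1 - zipf β i) ^ T ≤
      ∑ i ∈ Icc 1 k, (if n + 1 ≤ i then zipf β i else 0) +
      ∑ i ∈ Icc 1 k, (if i ∈ Icc 1 n then 1 / (T : ℝ) else 0) := by
    rw [← sum_add_distrib]
    refine sum_le_sum fun i hi => ?_
    rw [mem_Icc] at hi
    by_cases h : n + 1 ≤ i
    · rw [if_pos h, if_neg (by rw [mem_Icc]; omega), add_zero]
      exact term_le β hβ T i
    · rw [if_neg h, if_pos (by rw [mem_Icc]; omega), zero_add]
      exact term_le_inv β hβ T i hT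
  have h4 := (tail_summable β hβ n).sum_le_tsum (Icc 1 k) (fun i _ => by
    split_ifs
    · exact zipf_nonneg β hβ i
    · exact le_rfl)
  have h5 : ∑ i ∈ Icc 1 k, (if i ∈ Icc 1 n then 1 / (T : ℝ) else 0) ≤ n / T := by
    rw [← sum_filter]
    calc _ ≤ ∑ i ∈ Icc 1 n, 1 / (T : ℝ) := by
          refine sum_le_sum_of_subset_of_nonneg (fun i hi => (mem_filter.1 hi).2) ?_
          intros; positivity
      _ = _ := by simp; ring
  unfold EtestTail
  linarith

/-- Generic lower bound. -/
lemma E_lower (β : ℝ) (hβ : 1 < β) (T k n : ℕ) (hn : 1 ≤ n) (δ : ℝ) (hδ0 : 0 ≤ δ) (hδ : δ ≤ 1)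
    (h : ∀ i, n + 1 ≤ i → i ≤ k → δ ≤ (1 - zipf β i) ^ T) :
    δ * ((2 : ℝ) ^ (-β) * (n : ℝ) ^ (1 - β) / ∑' j : ℕ, ((j : ℝ) + 1) ^ (-β))
      ≤ EtestTail β T k := by
  have hZ := Z_ge_one β hβ
  have hn0 : (0 : ℝ) < n := by exact_mod_cast hn
  have a1 : ∀ i ∈ Icc (n + 1) (2 * n),
      (2 : ℝ) ^ (-β) * (n : ℝ) ^ (-β) / ∑' j : ℕ, ((j : ℝ) + 1) ^ (-β) ≤ zipf β i := by
    intro i hi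
    rw [mem_Icc] at hi
    unfold zipf
    rw [← Real.mul_rpow (by norm_num) hn0.le]
    refine div_le_div_of_nonneg_right ?_ (by linarith)
    apply Real.rpow_le_rpow_of_nonpos
    · exact_mod_cast (by omega : 0 < i)
    · exact_mod_cast hi.2
    · linarith
  have a2 : δ * ((2 : ℝ) ^ (-β) * (n : ℝ) ^ (1 - β) / ∑' j : ℕ, ((j : ℝ) + 1) ^ (-β)) ≤
      ∑ i ∈ Icc (n + 1) (2 * n), δ * zipf β i := by
    rw [← mul_sum]
    refine mul_le_mul_of_nonneg_left ?_ hδ0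
    refine le_trans (le_of_eq ?_) (card_nsmul_le_sum _ _ _ a1)
    rw [Nat.card_Icc, show 2 * n + 1 - (n + 1) = n by omega, nsmul_eq_mul, sub_eq_add_neg,
      Real.rpow_add hn0, Real.rpow_one]
    ring
  have a3 : ∑ i ∈ Icc (n + 1) (2 * n), δ * zipf β i ≤
      ∑ i ∈ Icc (n + 1) (2 * n), (if k + 1 ≤ i then zipf β i else 0) +
      ∑ i ∈ Icc (n + 1) (2 * n),
        (if i ∈ Icc 1 k then zipf β i * (1 - zipf β i) ^ T else 0) := by
    rw [← sum_add_distrib]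
    refine sum_le_sum fun i hi => ?_
    rw [mem_Icc] at hi
    have hp := zipf_nonneg β hβ i
    by_cases hk : k + 1 ≤ i
    · rw [if_pos hk, if_neg (by rw [mem_Icc]; omega)]
      nlinarith
    · rw [if_neg hk, if_pos (by rw [mem_Icc]; omega)]
      have := h i hi.1 (by omega)
      nlinarith
  have a4 := (tail_summable β hβ k).sum_le_tsum (Icc (n + 1) (2 * n)) (fun i _ => by
    split_ifs
    · exact zipf_nonneg β hβ i
    · exact le_rfl)
  have a5 : ∑ i ∈ Icc (n + 1) (2 * n),
        (if i ∈ Icc 1 k then zipf β i * (1 - zipf β i) ^ T else 0) ≤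
      ∑ i ∈ Icc 1 k, zipf β i * (1 - zipf β i) ^ T := by
    rw [← sum_filter]
    refine sum_le_sum_of_subset_of_nonneg (fun i hi => (mem_filter.1 hi).2) ?_
    intro i _ _
    exact term_nonneg β hβ T i
  unfold EtestTail
  linarith

lemma rpow_root (β : ℝ) (hβ : 1 < β) (x : ℝ) (hx : 0 ≤ x) :
    (x ^ (1 / β)) ^ (1 - β) = x ^ (-(1 - 1 / β)) := by
  rw [← Real.rpow_mul hx]
  congr 1
  have : β ≠ 0 := by linarith
  field_simp; ring

lemma E_upper' (β : ℝ) (hβ : 1 < β) : ∃ C : ℝ, 0 < C ∧ ∀ T k : ℕ, 1 ≤ T → 1 ≤ k →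
    EtestTail β T k ≤ C * ((T : ℝ) ^ (-(1 - 1 / β)) + (k : ℝ) ^ (-(β - 1))) := by
  have hb : 0 < β - 1 := by linarith
  refine ⟨1 / (β - 1) + 2, by positivity, fun T k hT hk => ?_⟩
  have hT1 : (1 : ℝ) ≤ T := by exact_mod_cast hT
  have hT0 : (0 : ℝ) < T := by linarith
  have hr : (1 : ℝ) ≤ (T : ℝ) ^ (1 / β) := Real.one_le_rpow hT1 (by positivity)
  have hn1 : 1 ≤ ⌈(T : ℝ) ^ (1 / β)⌉₊ := Nat.one_le_ceil_iff.2 (by linarith)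
  have hnlo := Nat.le_ceil ((T : ℝ) ^ (1 / β))
  have hnhi := (Nat.ceil_lt_add_one (by linarith : 0 ≤ (T : ℝ) ^ (1 / β))).le
  have h := E_upper β hβ T k _ hT hk hn1
  set n := ⌈(T : ℝ) ^ (1 / β)⌉₊
  have h1 : (n : ℝ) ^ (1 - β) ≤ (T : ℝ) ^ (-(1 - 1 / β)) := by
    rw [← rpow_root β hβ T hT0.le]
    exact Real.rpow_le_rpow_of_nonpos (by linarith) hnlo (by linarith)
  have h2 : (n : ℝ) / T ≤ 2 * (T : ℝ) ^ (-(1 - 1 / β)) := by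
    rw [show -(1 - 1 / β) = 1 / β - 1 by ring, Real.rpow_sub_one hT0.ne', ← mul_div_assoc]
    gcongr; linarith
  have h3 : (n : ℝ) ^ (1 - β) / (β - 1) ≤ (T : ℝ) ^ (-(1 - 1 / β)) / (β - 1) := by gcongr
  have h4 : (0 : ℝ) ≤ (k : ℝ) ^ (-(β - 1)) := by positivity
  rw [show 1 - β = -(β - 1) by ring] at h h3
  calc _ ≤ _ := h
    _ ≤ (k : ℝ) ^ (-(β - 1)) / (β - 1) + (T : ℝ) ^ (-(1 - 1 / β)) / (β - 1)
        + 2 * (T : ℝ) ^ (-(1 - 1 / β)) + 2 * (k : ℝ) ^ (-(β - 1)) := by linarith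
    _ = _ := by ring

lemma E_lower' (β : ℝ) (hβ : 1 < β) : ∃ C : ℝ, 0 < C ∧ ∀ T k : ℕ, 1 ≤ T → 1 ≤ k →
    C * ((T : ℝ) ^ (-(1 - 1 / β)) + (k : ℝ) ^ (-(β - 1))) ≤ EtestTail β T k := by
  have hb : 0 < β - 1 := by linarith
  have hZ := Z_ge_one β hβ
  obtain ⟨Z, hZe⟩ : ∃ Z, Z = ∑' j : ℕ, ((j : ℝ) + 1) ^ (-β) := ⟨_, rfl⟩
  rw [← hZe] at hZ
  set A : ℝ := 2 ^ (-β) / Z with hA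
  have hA0 : 0 < A := by positivity
  set B : ℝ := 1 / 2 * (A * (2 ^ (1 - β) * 2 ^ (-(1 - 1 / β)))) with hB
  have hB0 : 0 < B := by positivity
  refine ⟨min A B / 2, by positivity, fun T k hT hk => ?_⟩
  have hT1 : (1 : ℝ) ≤ T := by exact_mod_cast hT
  have hT0 : (0 : ℝ) < T := by linarith
  have e1 : A * (k : ℝ) ^ (-(β - 1)) ≤ EtestTail β T k := by
    have := E_lower β hβ T k k hk 1 zero_le_one le_rfl (fun i h1 h2 => by omega)
    rw [← hZe] at this
    refine le_trans (le_of_eq ?_) this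
    rw [show 1 - β = -(β - 1) by ring, hA]; ring
  have e2 : B * (T : ℝ) ^ (-(1 - 1 / β)) ≤ EtestTail β T k := by
    have hr : (1 : ℝ) ≤ (2 * T : ℝ) ^ (1 / β) := Real.one_le_rpow (by linarith) (by positivity)
    have hn1 : 1 ≤ ⌈(2 * T : ℝ) ^ (1 / β)⌉₊ := Nat.one_le_ceil_iff.2 (by linarith)
    have hnlo := Nat.le_ceil ((2 * T : ℝ) ^ (1 / β))
    have hnhi := (Nat.ceil_lt_add_one (by linarith : 0 ≤ (2 * T : ℝ) ^ (1 / β))).le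
    have h := E_lower β hβ T k _ hn1 (1 / 2) (by norm_num) (by norm_num) (fun i h1 h2 => by
      have hi : (2 * T : ℝ) ^ (1 / β) ≤ i := hnlo.trans (Nat.cast_le.2 (by omega))
      have hi2 : (i : ℝ) ^ (-β) ≤ (2 * T : ℝ)⁻¹ := by
        refine (Real.rpow_le_rpow_of_nonpos (by linarith) hi (by linarith)).trans (le_of_eq ?_)
        rw [← Real.rpow_mul (by positivity), ← Real.rpow_neg_one]
        congr 1
        have : β ≠ 0 := by linarith
        field_simp
      have hz := (zipf_le β hβ i).trans hi2
      have hz1 := zipf_le_one β hβ i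
      have hbn := one_add_mul_le_pow (a := -zipf β i) (by linarith) T
      have : (T : ℝ) * zipf β i ≤ 1 / 2 := by
        refine (mul_le_mul_of_nonneg_left hz hT0.le).trans (le_of_eq ?_)
        field_simp
      rw [sub_eq_add_neg]
      linarith)
    rw [← hZe] at h
    set n := ⌈(2 * T : ℝ) ^ (1 / β)⌉₊
    have hn0 : (0 : ℝ) < n := by exact_mod_cast hn1
    have g : 2 ^ (1 - β) * 2 ^ (-(1 - 1 / β)) * (T : ℝ) ^ (-(1 - 1 / β)) ≤ (n : ℝ) ^ (1 - β) := by
      rw [mul_assoc, ← Real.mul_rpow (by norm_num) hT0.le, ← rpow_root β hβ _ (by positivity),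
        ← Real.mul_rpow (by norm_num) (by positivity)]
      exact Real.rpow_le_rpow_of_nonpos hn0 (by linarith) (by linarith)
    refine le_trans ?_ h
    calc _ = 1 / 2 * (A * (2 ^ (1 - β) * 2 ^ (-(1 - 1 / β)) * (T : ℝ) ^ (-(1 - 1 / β)))) := by
          rw [hB]; ring
      _ ≤ 1 / 2 * (A * (n : ℝ) ^ (1 - β)) := by gcongr
      _ = _ := by rw [hA]; ring
  have x1 : (0 : ℝ) ≤ (k : ℝ) ^ (-(β - 1)) := by positivity
  have x2 : (0 : ℝ) ≤ (T : ℝ) ^ (-(1 - 1 / β)) := by positivity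
  have y1 := mul_le_mul_of_nonneg_right (min_le_left A B) x1
  have y2 := mul_le_mul_of_nonneg_right (min_le_right A B) x2
  linarith

lemma min_pow (β : ℝ) (hβ : 1 < β) (T k : ℕ) (hT : 1 ≤ T) (hk : 1 ≤ k) :
    (min (T : ℝ) ((k : ℝ) ^ β)) ^ (-(1 - 1 / β)) ≤
      (T : ℝ) ^ (-(1 - 1 / β)) + (k : ℝ) ^ (-(β - 1)) ∧
    (T : ℝ) ^ (-(1 - 1 / β)) + (k : ℝ) ^ (-(β - 1)) ≤
      2 * (min (T : ℝ) ((k : ℝ) ^ β)) ^ (-(1 - 1 / β)) := by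
  have hT0 : (0 : ℝ) < T := by exact_mod_cast hT
  have hk0 : (0 : ℝ) < k := by exact_mod_cast hk
  have hkb : (0 : ℝ) < (k : ℝ) ^ β := by positivity
  have hc : -(1 - 1 / β) ≤ 0 := by
    have : 1 / β ≤ 1 := by rw [div_le_one (by linarith)]; linarith
    linarith
  have e : (k : ℝ) ^ (-(β - 1)) = ((k : ℝ) ^ β) ^ (-(1 - 1 / β)) := by
    rw [← Real.rpow_mul hk0.le]
    congr 1
    have : β ≠ 0 := by linarith
    field_simp
  rw [e]
  have p1 : 0 ≤ (T : ℝ) ^ (-(1 - 1 / β)) := by positivity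
  have p2 : 0 ≤ ((k : ℝ) ^ β) ^ (-(1 - 1 / β)) := by positivity
  have hm : 0 < min (T : ℝ) ((k : ℝ) ^ β) := lt_min hT0 hkb
  constructor
  · rcases min_choice (T : ℝ) ((k : ℝ) ^ β) with h | h <;> rw [h] <;> linarith
  · have q1 := Real.rpow_le_rpow_of_nonpos hm (min_le_left _ _) hc
    have q2 := Real.rpow_le_rpow_of_nonpos hm (min_le_right _ _) hc
    linarith

end Aux

/-- For `β > 1`, `c = 1 - 1/β`, the test error of the Hutter model
trained on tail-chopped data satisfies `E(T,k) ≍ T^(-c) + k^(-(β-1))`, equivalently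
`E(T,k) ≍ min(T, k^β)^(-c)`, for all large `T` and `k`. -/
theorem model_collapse_hutter (β : ℝ) (hβ : 1 < β) (c : ℝ) (hc : c = 1 - 1 / β) :
    ∃ C₁ C₂ : ℝ, 0 < C₁ ∧ 0 < C₂ ∧ ∃ T₀ k₀ : ℕ,
      (∀ T k : ℕ, T₀ ≤ T → k₀ ≤ k →
        C₁ * ((T : ℝ) ^ (-c) + (k : ℝ) ^ (-(β - 1))) ≤ EtestTail β T k ∧
        EtestTail β T k ≤ C₂ * ((T : ℝ) ^ (-c) + (k : ℝ) ^ (-(β - 1)))) ∧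
      ∃ C₃ C₄ : ℝ, 0 < C₃ ∧ 0 < C₄ ∧
      (∀ T k : ℕ, T₀ ≤ T → k₀ ≤ k →
        C₃ * (min (T : ℝ) ((k : ℝ) ^ β)) ^ (-c) ≤ EtestTail β T k ∧
        EtestTail β T k ≤ C₄ * (min (T : ℝ) ((k : ℝ) ^ β)) ^ (-c)) := by
  subst hc
  obtain ⟨C₁, h1, hlo⟩ := E_lower' β hβ
  obtain ⟨C₂, h2, hup⟩ := E_upper' β hβ
  refine ⟨C₁, C₂, h1, h2, 1, 1, fun T k hT hk => ⟨hlo T k hT hk, hup T k hT hk⟩,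
    C₁, 2 * C₂, h1, by positivity, fun T k hT hk => ?_⟩
  obtain ⟨m1, m2⟩ := min_pow β hβ T k hT hk
  constructor
  · exact (mul_le_mul_of_nonneg_left m1 h1.le).trans (hlo T k hT hk)
  · refine (hup T k hT hk).trans ((mul_le_mul_of_nonneg_left m2 h2.le).trans (le_of_eq ?_))
    ring
end

section
/- Fix β ∈ (1,2) and set c := 1 − 1/β (= min(1 − 1/β, 1/2) in this range). Let p = (p_i) be a probability distribution on the positive integers with Σ_i p_i^{1−c} < ∞, and suppose the maps π_i are bijections of the positive integers (permutations), with conditional distributions p(j|i) := π_i(j)^{-β}/ζ(β). Train the Hutter++ estimator on T iid pairs (i_t, j_t) with i_t ~ p and j_t | i_t ~ p(·|i_t). Then there exist constants C₁, C₂ > 0 and T₀, depending only on β and p, such that for all T ≥ T₀: C₁·T^{-c} ≤ E_test(T) ≤ C₂·T^{-c}. Thus the autoregressive bigram model obeys exactly the same scaling law as the classical Hutter setup. -/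
open MeasureTheory

/-- The discrete measurable structure on the positive integers. -/
instance : MeasurableSpace ℕ+ := ⊤

/-- Conditional next-token distribution of the tailed bigram (Hutter++) model with
permutations: `p(j|i) = π_i(j)^(-β) / ζ(β)` where `ζ(β) = ∑_{m ≥ 1} m^(-β)`. -/
noncomputable def condP (β : ℝ) (πm : ℕ+ → ℕ+ → ℕ+) (i j : ℕ+) : ℝ :=
  ((πm i j : ℕ) : ℝ) ^ (-β) / ∑' m : ℕ+, ((m : ℕ) : ℝ) ^ (-β)

/-- `n_T(i)`: number of occurrences of the context `i` in the sample `s`. -/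
def nCtx {T : ℕ} (s : Fin T → ℕ+ × ℕ+) (i : ℕ+) : ℕ :=
  (Finset.univ.filter fun t => (s t).1 = i).card

/-- `n_T(i,j)`: number of occurrences of the pair `(i,j)` in the sample `s`. -/
def nPair {T : ℕ} (s : Fin T → ℕ+ × ℕ+) (i j : ℕ+) : ℕ :=
  (Finset.univ.filter fun t => s t = (i, j)).card

/-- The empirical conditional `q_T(j|i) = n_T(i,j)/n_T(i)` if `n_T(i) ≥ 1`, else `0`. -/
noncomputable def qEmp {T : ℕ} (s : Fin T → ℕ+ × ℕ+) (i j : ℕ+) : ℝ :=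
  if 1 ≤ nCtx s i then (nPair s i j : ℝ) / (nCtx s i : ℝ) else 0

/-- The TV-based test error `E_test(T) = ∑_i p_i 𝔼[∑_j |q_T(j|i) − cond(j|i)|]`, the
expectation being over a training set of `T` iid pairs drawn from the measure `μ`. -/
noncomputable def EtestBigram (p : ℕ+ → ℝ) (cond : ℕ+ → ℕ+ → ℝ)
    (μ : Measure (ℕ+ × ℕ+)) (T : ℕ) : ℝ :=
  ∑' i : ℕ+, p i *
    ∫ s : Fin T → ℕ+ × ℕ+, (∑' j : ℕ+, |qEmp s i j - cond i j|)
      ∂(Measure.pi fun _ : Fin T => μ)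

lemma hpp_head_step (s : ℝ) (hs0 : 0 < s) (hs1 : s < 1) (m : ℕ) :
    (1 - s) * ((m : ℝ) + 1) ^ (-s) ≤ ((m : ℝ) + 1) ^ (1 - s) - (m : ℝ) ^ (1 - s) := by
  have hb : (0 : ℝ) < (m : ℝ) + 1 := by positivity
  have h1 : (1 + -(1 / ((m : ℝ) + 1))) ^ (1 - s) ≤ 1 + (1 - s) * (-(1 / ((m : ℝ) + 1))) := by
    apply rpow_one_add_le_one_add_mul_self
    · have : 1 / ((m : ℝ) + 1) ≤ 1 := by
        rw [div_le_one hb]; linarith [(Nat.cast_nonneg m : (0 : ℝ) ≤ m)]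
      linarith
    · linarith
    · linarith
  have h2 : (1 + -(1 / ((m : ℝ) + 1))) = m / (m + 1) := by field_simp; ring
  rw [h2, Real.div_rpow (Nat.cast_nonneg m) hb.le, div_le_iff₀ (by positivity)] at h1
  have h3 : ((m : ℝ) + 1) ^ (1 - s) = ((m : ℝ) + 1) * ((m : ℝ) + 1) ^ (-s) := by
    rw [sub_eq_add_neg, Real.rpow_add hb, Real.rpow_one]
  have h4 : (1 + (1 - s) * (-(1 / ((m : ℝ) + 1)))) * ((m : ℝ) + 1) ^ (1 - s)
      = ((m : ℝ) + 1) ^ (1 - s) - (1 - s) * ((m : ℝ) + 1) ^ (-s) := by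
    rw [h3]; field_simp; ring
  linarith

lemma hpp_head (s : ℝ) (hs0 : 0 < s) (hs1 : s < 1) (M : ℕ) :
    ∑ m ∈ Finset.range M, ((m : ℝ) + 1) ^ (-s) ≤ (M : ℝ) ^ (1 - s) / (1 - s) := by
  rw [le_div_iff₀ (by linarith)]
  induction M with
  | zero => simp; rw [Real.zero_rpow (by linarith)]
  | succ k ih =>
    rw [Finset.sum_range_succ, add_mul]
    have := hpp_head_step s hs0 hs1 k
    push_cast
    linarith

lemma hpp_tail_step (β : ℝ) (hβ1 : 1 < β) (hβ2 : β < 2) (m : ℕ) (hm : 1 ≤ m) :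
    (β - 1) * ((m : ℝ) + 1) ^ (-β) ≤ (m : ℝ) ^ (1 - β) - ((m : ℝ) + 1) ^ (1 - β) := by
  have hb : (0 : ℝ) < (m : ℝ) + 1 := by positivity
  have ha : (0 : ℝ) < (m : ℝ) := by exact_mod_cast hm
  have h := hpp_head_step (2 - β) (by linarith) (by linarith) m
  have e1 : 1 - (2 - β) = β - 1 := by ring
  rw [e1] at h
  have f1 : ((m : ℝ) + 1) ^ (1 - β) = (((m : ℝ) + 1) ^ (β - 1))⁻¹ := by
    rw [← Real.rpow_neg hb.le]; congr 1; ring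
  have f2 : (m : ℝ) ^ (1 - β) = ((m : ℝ) ^ (β - 1))⁻¹ := by
    rw [← Real.rpow_neg ha.le]; congr 1; ring
  have f3 : ((m : ℝ) + 1) ^ (-β) = ((m : ℝ) + 1)⁻¹ * (((m : ℝ) + 1) ^ (β - 1))⁻¹ := by
    rw [← Real.rpow_neg hb.le, ← Real.rpow_neg_one, ← Real.rpow_add hb]; congr 1; ring
  have f4 : ((m : ℝ) + 1) ^ (-(2 - β)) = ((m : ℝ) + 1)⁻¹ * (((m : ℝ) + 1) ^ (β - 1)) := by
    rw [← Real.rpow_neg_one, ← Real.rpow_add hb]; congr 1; ring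
  rw [f4] at h
  rw [f1, f2, f3]
  have hA : 0 < (m : ℝ) ^ (β - 1) := by positivity
  have hB : 0 < ((m : ℝ) + 1) ^ (β - 1) := by positivity
  have hAB : (m : ℝ) ^ (β - 1) ≤ ((m : ℝ) + 1) ^ (β - 1) :=
    Real.rpow_le_rpow ha.le (by linarith) (by linarith)
  generalize (m : ℝ) ^ (β - 1) = A at *
  generalize ((m : ℝ) + 1) ^ (β - 1) = B at *
  have hK : (β - 1) * ((m : ℝ) + 1)⁻¹ * B ≤ B - A := by linarith
  have hK0 : 0 ≤ (β - 1) * ((m : ℝ) + 1)⁻¹ := mul_nonneg (by linarith) (by positivity)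
  have e : (β - 1) * (((m : ℝ) + 1)⁻¹ * B⁻¹) = (β - 1) * ((m : ℝ) + 1)⁻¹ * B⁻¹ := by ring
  rw [e]
  generalize (β - 1) * ((m : ℝ) + 1)⁻¹ = K at *
  have e2 : A⁻¹ - B⁻¹ - K * B⁻¹ = (B - A - K * A) / (A * B) := by field_simp
  have : 0 ≤ (B - A - K * A) / (A * B) := by
    apply div_nonneg _ (by positivity)
    nlinarith
  linarith

lemma hpp_tail_fin (β : ℝ) (hβ1 : 1 < β) (hβ2 : β < 2) (M : ℕ) (hM : 1 ≤ M) (k : ℕ) :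
    ∑ m ∈ Finset.range (M + k), ((m : ℝ) + 1) ^ (-β) ≤
      ∑ m ∈ Finset.range M, ((m : ℝ) + 1) ^ (-β) +
        ((M : ℝ) ^ (1 - β) - ((M + k : ℕ) : ℝ) ^ (1 - β)) / (β - 1) := by
  induction k with
  | zero => simp
  | succ k ih =>
    rw [← add_assoc, Finset.sum_range_succ]
    have h := hpp_tail_step β hβ1 hβ2 (M + k) (by omega)
    have h' : (((M + k : ℕ) : ℝ) + 1) ^ (-β) ≤
        (((M + k : ℕ) : ℝ) ^ (1 - β) - (((M + k : ℕ) : ℝ) + 1) ^ (1 - β)) / (β - 1) := by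
      rw [le_div_iff₀ (by linarith)]; linarith
    rw [Nat.cast_succ]
    rw [sub_div] at *
    linarith

lemma hpp_summable (β : ℝ) (hβ1 : 1 < β) : Summable fun m : ℕ+ => ((m : ℕ) : ℝ) ^ (-β) := by
  have : Summable fun m : ℕ => (m : ℝ) ^ (-β) := Real.summable_nat_rpow.2 (by linarith)
  exact this.comp_injective PNat.coe_injective

lemma hpp_tsum_eq (β : ℝ) :
    (∑' m : ℕ+, ((m : ℕ) : ℝ) ^ (-β)) = ∑' m : ℕ, ((m : ℝ) + 1) ^ (-β) := by
  rw [tsum_pnat_eq_tsum_succ (f := fun m : ℕ => (m : ℝ) ^ (-β))]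
  simp

lemma hpp_tail (β : ℝ) (hβ1 : 1 < β) (hβ2 : β < 2) (M : ℕ) (hM : 1 ≤ M) :
    (∑' m : ℕ+, ((m : ℕ) : ℝ) ^ (-β)) ≤
      ∑ m ∈ Finset.range M, ((m : ℝ) + 1) ^ (-β) + (M : ℝ) ^ (1 - β) / (β - 1) := by
  rw [hpp_tsum_eq]
  apply Real.tsum_le_of_sum_range_le
  · intro n; positivity
  · intro n
    refine le_trans (Finset.sum_le_sum_of_subset_of_nonneg
      (Finset.range_mono (by omega : n ≤ M + n)) (fun _ _ _ => by positivity)) ?_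
    refine (hpp_tail_fin β hβ1 hβ2 M hM n).trans ?_
    have : 0 ≤ ((M + n : ℕ) : ℝ) ^ (1 - β) := by positivity
    gcongr
    · linarith

lemma hpp_Z_ge (β : ℝ) (hβ1 : 1 < β) : 1 ≤ ∑' m : ℕ+, ((m : ℕ) : ℝ) ^ (-β) := by
  have := (hpp_summable β hβ1).le_tsum 1 (fun _ _ => by positivity)
  simpa using this

instance hppDisc : DiscreteMeasurableSpace ℕ+ := ⟨fun _ => trivial⟩

lemma hpp_integrable {Ω : Type*} [MeasurableSpace Ω] [DiscreteMeasurableSpace Ω] [Countable Ω]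
    (ν : Measure Ω) [IsFiniteMeasure ν] (f : Ω → ℝ) (B : ℝ) (h : ∀ x, |f x| ≤ B) :
    Integrable f ν :=
  Integrable.of_bound (Measurable.of_discrete.aestronglyMeasurable) B
    (Filter.Eventually.of_forall h)

/-- second moment of a sum of iid centered variables -/
lemma hpp_second_moment (μ : Measure (ℕ+ × ℕ+)) [IsProbabilityMeasure μ] (T : ℕ)
    (f : ℕ+ × ℕ+ → ℝ) (B : ℝ) (hB : ∀ x, |f x| ≤ B) (h0 : ∫ x, f x ∂μ = 0) :
    ∫ s : Fin T → ℕ+ × ℕ+, (∑ t, f (s t)) ^ 2 ∂(Measure.pi fun _ : Fin T => μ)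
      = T * ∫ x, f x ^ 2 ∂μ := by
  have hL : MemLp f 2 μ :=
    MemLp.of_bound (Measurable.of_discrete.aestronglyMeasurable) B (Filter.Eventually.of_forall hB)
  have h := ProbabilityTheory.variance_sum_pi (μ := fun _ : Fin T => μ) (X := fun _ => f)
    (fun _ => hL)
  have hm : ∫ s : Fin T → ℕ+ × ℕ+, (∑ t, fun s : Fin T → ℕ+ × ℕ+ => f (s t)) s
      ∂(Measure.pi fun _ : Fin T => μ) = 0 := by
    simp only [Finset.sum_apply]
    rw [integral_finsetSum]
    · apply Finset.sum_eq_zero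
      intro t _
      rw [integral_comp_eval (μ := fun _ : Fin T => μ) hL.aestronglyMeasurable, h0]
    · intro t _
      exact hpp_integrable _ _ B (fun s => hB _)
  rw [ProbabilityTheory.variance_of_integral_eq_zero Measurable.of_discrete.aemeasurable hm,
    ProbabilityTheory.variance_of_integral_eq_zero Measurable.of_discrete.aemeasurable h0] at h
  simpa using h

lemma hpp_integral_sum (μ : Measure (ℕ+ × ℕ+)) [IsProbabilityMeasure μ] (T : ℕ)
    (f : ℕ+ × ℕ+ → ℝ) (B : ℝ) (hB : ∀ x, |f x| ≤ B) :
    ∫ s : Fin T → ℕ+ × ℕ+, (∑ t, f (s t)) ∂(Measure.pi fun _ : Fin T => μ)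
      = T * ∫ x, f x ∂μ := by
  rw [integral_finsetSum]
  · simp_rw [integral_comp_eval (μ := fun _ : Fin T => μ) (f := f)
      Measurable.of_discrete.aestronglyMeasurable]
    simp
  · intro t _
    exact hpp_integrable _ _ B (fun s => hB _)

lemma hpp_sum_bdd {T : ℕ} (f : ℕ+ × ℕ+ → ℝ) (B : ℝ) (hB : ∀ x, |f x| ≤ B)
    (s : Fin T → ℕ+ × ℕ+) : |∑ t, f (s t)| ≤ T * B := by
  refine (Finset.abs_sum_le_sum_abs _ _).trans ?_
  refine (Finset.sum_le_sum (fun t _ => hB (s t))).trans ?_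
  simp

/-- indicator functions -/
noncomputable def hppI (i : ℕ+) (x : ℕ+ × ℕ+) : ℝ := if x.1 = i then 1 else 0
noncomputable def hppJ (i j : ℕ+) (x : ℕ+ × ℕ+) : ℝ := if x = (i, j) then 1 else 0

lemma hpp_nCtx {T : ℕ} (s : Fin T → ℕ+ × ℕ+) (i : ℕ+) :
    (nCtx s i : ℝ) = ∑ t, hppI i (s t) := by
  simp [nCtx, hppI]

lemma hpp_nPair {T : ℕ} (s : Fin T → ℕ+ × ℕ+) (i j : ℕ+) :
    (nPair s i j : ℝ) = ∑ t, hppJ i j (s t) := by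
  simp [nPair, hppJ]

lemma hppI_bd (i : ℕ+) (x) : |hppI i x| ≤ 1 := by unfold hppI; split_ifs <;> simp
lemma hppJ_bd (i j : ℕ+) (x) : |hppJ i j x| ≤ 1 := by unfold hppJ; split_ifs <;> simp

lemma hppJ_int (μ : Measure (ℕ+ × ℕ+)) [IsProbabilityMeasure μ] (i j : ℕ+) (a : ℝ) (ha : 0 ≤ a)
    (h : μ {(i, j)} = ENNReal.ofReal a) : ∫ x, hppJ i j x ∂μ = a := by
  have : hppJ i j = Set.indicator {(i, j)} (fun _ => (1 : ℝ)) := by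
    ext x; simp [hppJ, Set.indicator]
  rw [this, integral_indicator (MeasurableSet.of_discrete)]
  simp [Measure.real, h, ha]

lemma hppI_int (μ : Measure (ℕ+ × ℕ+)) [IsProbabilityMeasure μ] (i : ℕ+) (a : ℝ) (ha : 0 ≤ a)
    (P : ℕ+ → ℝ) (hP : ∀ j, 0 ≤ P j) (hs : HasSum P 1)
    (h : ∀ j, μ {(i, j)} = ENNReal.ofReal (a * P j)) : ∫ x, hppI i x ∂μ = a := by
  have : hppI i = Set.indicator {x | x.1 = i} (fun _ => (1 : ℝ)) := by
    ext x; simp [hppI, Set.indicator]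
  rw [this, integral_indicator (MeasurableSet.of_discrete)]
  have hU : {x : ℕ+ × ℕ+ | x.1 = i} = ⋃ j : ℕ+, {(i, j)} := by
    ext ⟨x, y⟩; simp [eq_comm]
  have hm : μ {x : ℕ+ × ℕ+ | x.1 = i} = ENNReal.ofReal a := by
    rw [hU, measure_iUnion]
    · simp_rw [h]
      rw [← ENNReal.ofReal_tsum_of_nonneg (fun j => mul_nonneg ha (hP j)) (hs.summable.mul_left a),
        tsum_mul_left, hs.tsum_eq, mul_one]
    · intro j k hjk
      simpa [Function.onFun] using hjk
    · intro j; exact MeasurableSet.of_discrete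
  simp [Measure.real, hm, ha]

lemma hpp_qnonneg {T : ℕ} (s : Fin T → ℕ+ × ℕ+) (i j : ℕ+) : 0 ≤ qEmp s i j := by
  unfold qEmp; split_ifs <;> positivity

lemma hpp_pair_sum {T : ℕ} (s : Fin T → ℕ+ × ℕ+) (i : ℕ+) (H : Finset ℕ+) :
    ∑ j ∈ H, (nPair s i j : ℝ) ≤ nCtx s i := by
  simp_rw [hpp_nPair, hpp_nCtx]
  rw [Finset.sum_comm]
  apply Finset.sum_le_sum
  intro t _
  unfold hppJ hppI
  by_cases h : (s t).1 = i
  · have : ∀ j, (s t = (i, j)) ↔ (s t).2 = j := by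
      intro j; rw [Prod.ext_iff]; simp [h]
    simp only [this, h, if_true]
    rw [Finset.sum_ite_eq]
    split_ifs <;> simp
  · have : ∀ j, ¬ (s t = (i, j)) := by
      intro j hj; exact h (by rw [hj])
    simp [this, h]

lemma hpp_q_sum {T : ℕ} (s : Fin T → ℕ+ × ℕ+) (i : ℕ+) (H : Finset ℕ+) :
    ∑ j ∈ H, qEmp s i j ≤ 1 := by
  unfold qEmp
  split_ifs with h
  · rw [← Finset.sum_div]
    have : (0 : ℝ) < nCtx s i := by exact_mod_cast h
    rw [div_le_one this]
    exact hpp_pair_sum s i H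
  · simp

lemma hpp_q_summable {T : ℕ} (s : Fin T → ℕ+ × ℕ+) (i : ℕ+) : Summable (qEmp s i) :=
  summable_of_sum_le (fun j => hpp_qnonneg s i j) (hpp_q_sum s i)

lemma hpp_q_tsum {T : ℕ} (s : Fin T → ℕ+ × ℕ+) (i : ℕ+) : ∑' j, qEmp s i j ≤ 1 :=
  (hpp_q_summable s i).tsum_le_of_sum_le (hpp_q_sum s i)

lemma hpp_F_summable {T : ℕ} (s : Fin T → ℕ+ × ℕ+) (i : ℕ+) (P : ℕ+ → ℝ) (hs : HasSum P 1) :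
    Summable fun j => |qEmp s i j - P j| := ((hpp_q_summable s i).sub hs.summable).abs

lemma hpp_F_le {T : ℕ} (s : Fin T → ℕ+ × ℕ+) (i : ℕ+) (P : ℕ+ → ℝ) (hP : ∀ j, 0 ≤ P j)
    (hs : HasSum P 1) (H : Finset ℕ+) :
    ∑' j, |qEmp s i j - P j| ≤ 2 * ∑ j ∈ H, |qEmp s i j - P j| + 2 * (1 - ∑ j ∈ H, P j) := by
  have hq := hpp_q_summable s i
  have hF := hpp_F_summable s i P hs
  have hg : Summable (fun j => |qEmp s i j - P j| - (qEmp s i j - P j)) :=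
    hF.sub (hq.sub hs.summable)
  have e1 : ∑' j, (|qEmp s i j - P j| - (qEmp s i j - P j)) =
      ∑' j, |qEmp s i j - P j| - (∑' j, qEmp s i j - 1) := by
    rw [hF.tsum_sub (hq.sub hs.summable), hq.tsum_sub hs.summable, hs.tsum_eq]
  have e2 := hg.sum_add_tsum_compl (s := H)
  have e3 := hs.summable.sum_add_tsum_compl (s := H)
  have b1 : ∑ j ∈ H, (|qEmp s i j - P j| - (qEmp s i j - P j)) ≤
      2 * ∑ j ∈ H, |qEmp s i j - P j| := by
    rw [Finset.mul_sum]
    apply Finset.sum_le_sum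
    intro j _
    linarith [neg_abs_le (qEmp s i j - P j)]
  have b2 : ∑' j : ↥((H : Set ℕ+)ᶜ), (|qEmp s i j - P j| - (qEmp s i j - P j)) ≤
      ∑' j : ↥((H : Set ℕ+)ᶜ), 2 * P j := by
    apply Summable.tsum_le_tsum
    · intro j
      rcases abs_cases (qEmp s i j - P j) with h | h <;>
        linarith [hpp_qnonneg s i j, hP j]
    · exact hg.subtype _
    · exact (hs.summable.mul_left 2).subtype _
  rw [tsum_mul_left] at b2
  rw [hs.tsum_eq] at e3
  have := hpp_q_tsum s i
  linarith

lemma hpp_F_nonneg {T : ℕ} (s : Fin T → ℕ+ × ℕ+) (i : ℕ+) (P : ℕ+ → ℝ) :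
    0 ≤ ∑' j, |qEmp s i j - P j| := tsum_nonneg (fun _ => abs_nonneg _)

lemma hpp_F_le_two {T : ℕ} (s : Fin T → ℕ+ × ℕ+) (i : ℕ+) (P : ℕ+ → ℝ) (hP : ∀ j, 0 ≤ P j)
    (hs : HasSum P 1) : ∑' j, |qEmp s i j - P j| ≤ 2 := by
  simpa using hpp_F_le s i P hP hs ∅

lemma hpp_F_int {T : ℕ} (μ : Measure (ℕ+ × ℕ+)) [IsProbabilityMeasure μ]
    (i : ℕ+) (P : ℕ+ → ℝ) (hP : ∀ j, 0 ≤ P j) (hs : HasSum P 1) :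
    Integrable (fun s : Fin T → ℕ+ × ℕ+ => ∑' j, |qEmp s i j - P j|)
      (Measure.pi fun _ : Fin T => μ) :=
  hpp_integrable _ _ 2 (fun s => by
    rw [abs_of_nonneg (hpp_F_nonneg s i P)]; exact hpp_F_le_two s i P hP hs)

lemma hpp_E_le_two {T : ℕ} (μ : Measure (ℕ+ × ℕ+)) [IsProbabilityMeasure μ]
    (i : ℕ+) (P : ℕ+ → ℝ) (hP : ∀ j, 0 ≤ P j) (hs : HasSum P 1) :
    ∫ s : Fin T → ℕ+ × ℕ+, (∑' j, |qEmp s i j - P j|) ∂(Measure.pi fun _ : Fin T => μ) ≤ 2 := by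
  refine (integral_mono (hpp_F_int μ i P hP hs) (integrable_const 2)
    (fun s => hpp_F_le_two s i P hP hs)).trans ?_
  simp

lemma hpp_E_nonneg {T : ℕ} (μ : Measure (ℕ+ × ℕ+)) (i : ℕ+) (P : ℕ+ → ℝ) :
    0 ≤ ∫ s : Fin T → ℕ+ × ℕ+, (∑' j, |qEmp s i j - P j|) ∂(Measure.pi fun _ : Fin T => μ) :=
  integral_nonneg (fun s => hpp_F_nonneg s i P)

/-- lower bound for one context -/
lemma hpp_lower {T : ℕ} (μ : Measure (ℕ+ × ℕ+)) [IsProbabilityMeasure μ]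
    (i : ℕ+) (a : ℝ) (ha : 0 ≤ a) (P : ℕ+ → ℝ) (hP : ∀ j, 0 ≤ P j) (hs : HasSum P 1)
    (h : ∀ j, μ {(i, j)} = ENNReal.ofReal (a * P j)) (H : Finset ℕ+) :
    ∑ j ∈ H, P j * (1 - T * (a * P j)) ≤
    ∫ s : Fin T → ℕ+ × ℕ+, (∑' j, |qEmp s i j - P j|) ∂(Measure.pi fun _ : Fin T => μ) := by
  have hint : ∀ j, Integrable (fun s : Fin T → ℕ+ × ℕ+ => ∑ t, hppJ i j (s t))
      (Measure.pi fun _ : Fin T => μ) := fun j =>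
    hpp_integrable _ _ (T * 1) (fun s => hpp_sum_bdd _ 1 (hppJ_bd i j) s)
  have hint2 : ∀ j ∈ H, Integrable (fun s : Fin T → ℕ+ × ℕ+ => P j * (1 - ∑ t, hppJ i j (s t)))
      (Measure.pi fun _ : Fin T => μ) := fun j _ =>
    ((integrable_const _).sub (hint j)).const_mul _
  have e : ∑ j ∈ H, P j * (1 - T * (a * P j)) =
      ∫ s : Fin T → ℕ+ × ℕ+, (∑ j ∈ H, P j * (1 - ∑ t, hppJ i j (s t)))
        ∂(Measure.pi fun _ : Fin T => μ) := by
    rw [integral_finsetSum _ hint2]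
    apply Finset.sum_congr rfl
    intro j _
    rw [integral_const_mul, integral_sub (integrable_const _) (hint j),
      hpp_integral_sum μ T _ 1 (hppJ_bd i j), hppJ_int μ i j _ (mul_nonneg ha (hP j)) (h j)]
    simp
  rw [e]
  apply integral_mono (integrable_finsetSum _ hint2) (hpp_F_int μ i P hP hs)
  intro s
  refine le_trans ?_ ((hpp_F_summable s i P hs).sum_le_tsum H (fun _ _ => abs_nonneg _))
  apply Finset.sum_le_sum
  intro j _
  rw [← hpp_nPair]
  rcases Nat.eq_zero_or_pos (nPair s i j) with h0 | h0
  · have : qEmp s i j = 0 := by unfold qEmp; simp [h0]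
    rw [this, h0]
    simp [abs_of_nonneg (hP j)]
  · have h1 : (1 : ℝ) ≤ nPair s i j := by exact_mod_cast h0
    have : P j * (1 - (nPair s i j : ℝ)) ≤ 0 := mul_nonpos_of_nonneg_of_nonpos (hP j) (by linarith)
    exact this.trans (abs_nonneg _)

/-- pointwise upper bound -/
lemma hpp_pointwise {T : ℕ} (s : Fin T → ℕ+ × ℕ+) (i : ℕ+) (P : ℕ+ → ℝ) (hP : ∀ j, 0 ≤ P j)
    (hs : HasSum P 1) (H : Finset ℕ+) (x : ℝ) (hx : 0 < x) :
    ∑' j, |qEmp s i j - P j| ≤ 8 / x ^ 2 * ((nCtx s i : ℝ) - x) ^ 2 +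
      4 / x * ∑ j ∈ H, |(nPair s i j : ℝ) - P j * nCtx s i| + 2 * (1 - ∑ j ∈ H, P j) := by
  have hPH : ∑ j ∈ H, P j ≤ 1 := sum_le_hasSum H (fun j _ => hP j) hs
  have hS : 0 ≤ 4 / x * ∑ j ∈ H, |(nPair s i j : ℝ) - P j * nCtx s i| := by positivity
  rcases le_total (x / 2) (nCtx s i : ℝ) with hA | hA
  · have h1 := hpp_F_le s i P hP hs H
    have hn : (0 : ℝ) < nCtx s i := by linarith
    have hn' : 1 ≤ nCtx s i := by exact_mod_cast hn
    have h2 : 2 * ∑ j ∈ H, |qEmp s i j - P j| ≤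
        4 / x * ∑ j ∈ H, |(nPair s i j : ℝ) - P j * nCtx s i| := by
      rw [Finset.mul_sum, Finset.mul_sum]
      apply Finset.sum_le_sum
      intro j _
      have : qEmp s i j - P j = ((nPair s i j : ℝ) - P j * nCtx s i) / nCtx s i := by
        unfold qEmp; rw [if_pos hn']; field_simp
      rw [this, abs_div, abs_of_pos hn]
      have h3 : 2 / (nCtx s i : ℝ) ≤ 4 / x := by
        rw [div_le_div_iff₀ hn hx]; linarith
      calc 2 * (|(nPair s i j : ℝ) - P j * nCtx s i| / nCtx s i)
          = 2 / (nCtx s i : ℝ) * |(nPair s i j : ℝ) - P j * nCtx s i| := by ring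
        _ ≤ _ := by gcongr
    have : 0 ≤ 8 / x ^ 2 * ((nCtx s i : ℝ) - x) ^ 2 := by positivity
    linarith
  · have h1 := hpp_F_le_two s i P hP hs
    have : 2 ≤ 8 / x ^ 2 * ((nCtx s i : ℝ) - x) ^ 2 := by
      rw [div_mul_eq_mul_div, le_div_iff₀ (by positivity)]
      nlinarith
    linarith

lemma hpp_sq_I (μ : Measure (ℕ+ × ℕ+)) [IsProbabilityMeasure μ] (T : ℕ)
    (i : ℕ+) (a : ℝ) (ha : 0 ≤ a) (hI : ∫ x, hppI i x ∂μ = a) :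
    ∫ s : Fin T → ℕ+ × ℕ+, ((nCtx s i : ℝ) - T * a) ^ 2 ∂(Measure.pi fun _ : Fin T => μ)
      ≤ T * a := by
  have iI : Integrable (hppI i) μ := hpp_integrable _ _ 1 (hppI_bd i)
  have e : ∀ s : Fin T → ℕ+ × ℕ+, (nCtx s i : ℝ) - T * a = ∑ t, (hppI i (s t) - a) := by
    intro s; rw [Finset.sum_sub_distrib, hpp_nCtx]; simp
  simp_rw [e]
  rw [hpp_second_moment μ T (fun x => hppI i x - a) (1 + |a|)]
  · have : ∀ x, (hppI i x - a) ^ 2 = (1 - 2 * a) * hppI i x + a ^ 2 := by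
      intro x; unfold hppI; split_ifs <;> ring
    simp_rw [this]
    rw [integral_add (iI.const_mul _) (integrable_const _), integral_const_mul, hI]
    simp
    have hT : (0 : ℝ) ≤ T := by positivity
    nlinarith [mul_nonneg hT (mul_nonneg ha ha)]
  · intro x
    exact (abs_sub _ _).trans (by linarith [hppI_bd i x])
  · rw [integral_sub iI (integrable_const _), hI]; simp

lemma hpp_abs_J (μ : Measure (ℕ+ × ℕ+)) [IsProbabilityMeasure μ] (T : ℕ)
    (i j : ℕ+) (a b : ℝ) (ha : 0 ≤ a) (hb : 0 ≤ b) (hI : ∫ x, hppI i x ∂μ = a)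
    (hJ : ∫ x, hppJ i j x ∂μ = a * b) :
    ∫ s : Fin T → ℕ+ × ℕ+, |(nPair s i j : ℝ) - b * nCtx s i| ∂(Measure.pi fun _ : Fin T => μ)
      ≤ Real.sqrt (T * a * b) := by
  have iI : Integrable (hppI i) μ := hpp_integrable _ _ 1 (hppI_bd i)
  have iJ : Integrable (hppJ i j) μ := hpp_integrable _ _ 1 (hppJ_bd i j)
  have e : ∀ s : Fin T → ℕ+ × ℕ+, (nPair s i j : ℝ) - b * nCtx s i =
      ∑ t, (hppJ i j (s t) - b * hppI i (s t)) := by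
    intro s; rw [Finset.sum_sub_distrib, hpp_nCtx, hpp_nPair, Finset.mul_sum]
  simp_rw [e]
  have hbd : ∀ x, |hppJ i j x - b * hppI i x| ≤ 1 + b := by
    intro x
    refine (abs_sub _ _).trans ?_
    rw [abs_mul, abs_of_nonneg hb]
    have := mul_le_mul_of_nonneg_left (hppI_bd i x) hb
    linarith [hppJ_bd i j x]
  have h2 : ∫ s : Fin T → ℕ+ × ℕ+, (∑ t, (hppJ i j (s t) - b * hppI i (s t))) ^ 2
      ∂(Measure.pi fun _ : Fin T => μ) ≤ T * a * b := by
    rw [hpp_second_moment μ T (fun x => hppJ i j x - b * hppI i x) (1 + b) hbd]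
    · have : ∀ x, (hppJ i j x - b * hppI i x) ^ 2
          = (1 - 2 * b) * hppJ i j x + b ^ 2 * hppI i x := by
        intro x; unfold hppI hppJ
        by_cases hx : x = (i, j)
        · subst hx; simp; ring
        · simp only [hx, if_false]; split_ifs <;> ring
      simp_rw [this]
      rw [integral_add (iJ.const_mul _) (iI.const_mul _), integral_const_mul, integral_const_mul,
        hI, hJ]
      have hT : (0 : ℝ) ≤ T := by positivity
      nlinarith [mul_nonneg hT (mul_nonneg ha (mul_nonneg hb hb))]
    · rw [integral_sub iJ (iI.const_mul _), integral_const_mul, hI, hJ]; ring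
  have hL : MemLp (fun s : Fin T → ℕ+ × ℕ+ => ∑ t, (hppJ i j (s t) - b * hppI i (s t))) 2
      (Measure.pi fun _ : Fin T => μ) :=
    MemLp.of_bound (Measurable.of_discrete.aestronglyMeasurable) (T * (1 + b))
      (Filter.Eventually.of_forall (fun s => hpp_sum_bdd _ _ hbd s))
  apply Real.le_sqrt_of_sq_le
  refine le_trans ?_ h2
  have hv := ProbabilityTheory.variance_nonneg
    (fun s : Fin T → ℕ+ × ℕ+ => |∑ t, (hppJ i j (s t) - b * hppI i (s t))|)
    (Measure.pi fun _ : Fin T => μ)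
  have hL' : MemLp (fun s : Fin T → ℕ+ × ℕ+ => |∑ t, (hppJ i j (s t) - b * hppI i (s t))|) 2
      (Measure.pi fun _ : Fin T => μ) := hL.abs
  rw [ProbabilityTheory.variance_eq_sub hL'] at hv
  simp only [Pi.pow_apply, sq_abs] at hv
  linarith

lemma hpp_upper {T : ℕ} (μ : Measure (ℕ+ × ℕ+)) [IsProbabilityMeasure μ]
    (i : ℕ+) (a : ℝ) (ha : 0 < a) (hT : 0 < T) (P : ℕ+ → ℝ) (hP : ∀ j, 0 ≤ P j) (hs : HasSum P 1)
    (h : ∀ j, μ {(i, j)} = ENNReal.ofReal (a * P j)) (H : Finset ℕ+) :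
    ∫ s : Fin T → ℕ+ × ℕ+, (∑' j, |qEmp s i j - P j|) ∂(Measure.pi fun _ : Fin T => μ) ≤
      8 / (T * a) + 4 / (T * a) * ∑ j ∈ H, Real.sqrt (T * a * P j) + 2 * (1 - ∑ j ∈ H, P j) := by
  have hT' : (0 : ℝ) < T := by exact_mod_cast hT
  have hx : 0 < T * a := by positivity
  have hI := hppI_int μ i a ha.le P hP hs h
  have hn : ∀ s : Fin T → ℕ+ × ℕ+, (nCtx s i : ℝ) ≤ T := by
    intro s
    have : nCtx s i ≤ T := by
      unfold nCtx; exact (Finset.card_filter_le _ _).trans (by simp)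
    exact_mod_cast this
  have hn2 : ∀ j, ∀ s : Fin T → ℕ+ × ℕ+, (nPair s i j : ℝ) ≤ T := by
    intro j s
    have : nPair s i j ≤ T := by
      unfold nPair; exact (Finset.card_filter_le _ _).trans (by simp)
    exact_mod_cast this
  have i1 : Integrable (fun s : Fin T → ℕ+ × ℕ+ =>
      8 / (T * a) ^ 2 * ((nCtx s i : ℝ) - T * a) ^ 2) (Measure.pi fun _ : Fin T => μ) := by
    apply Integrable.const_mul
    apply hpp_integrable _ _ ((T + T * a) ^ 2)
    intro s
    rw [abs_of_nonneg (sq_nonneg _)]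
    apply sq_le_sq'
    · linarith [(Nat.cast_nonneg (nCtx s i) : (0 : ℝ) ≤ _)]
    · linarith [hn s]
  have i2' : ∀ j ∈ H, Integrable (fun s : Fin T → ℕ+ × ℕ+ =>
      |(nPair s i j : ℝ) - P j * nCtx s i|) (Measure.pi fun _ : Fin T => μ) := by
    intro j _
    apply hpp_integrable _ _ (T + P j * T)
    intro s
    rw [abs_abs]
    refine (abs_sub _ _).trans ?_
    rw [abs_of_nonneg (by positivity), abs_of_nonneg (mul_nonneg (hP j) (by positivity))]
    have := mul_le_mul_of_nonneg_left (hn s) (hP j)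
    linarith [hn2 j s]
  have i2 : Integrable (fun s : Fin T → ℕ+ × ℕ+ =>
      4 / (T * a) * ∑ j ∈ H, |(nPair s i j : ℝ) - P j * nCtx s i|)
      (Measure.pi fun _ : Fin T => μ) := (integrable_finsetSum _ i2').const_mul _
  refine (integral_mono (hpp_F_int μ i P hP hs) ((i1.add i2).add
    (integrable_const (2 * (1 - ∑ j ∈ H, P j))))
    (fun s => hpp_pointwise s i P hP hs H (T * a) hx)).trans ?_
  rw [integral_add' (i1.add i2) (integrable_const _), integral_add' i1 i2, integral_const_mul, integral_const_mul, integral_finsetSum _ i2']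
  have k1 : 8 / (T * a) ^ 2 * ∫ s : Fin T → ℕ+ × ℕ+, ((nCtx s i : ℝ) - T * a) ^ 2
      ∂(Measure.pi fun _ : Fin T => μ) ≤ 8 / (T * a) := by
    refine (mul_le_mul_of_nonneg_left (hpp_sq_I μ T i a ha.le hI) (by positivity)).trans ?_
    apply le_of_eq; field_simp
  have k2 : ∑ j ∈ H, ∫ s : Fin T → ℕ+ × ℕ+, |(nPair s i j : ℝ) - P j * nCtx s i|
      ∂(Measure.pi fun _ : Fin T => μ) ≤ ∑ j ∈ H, Real.sqrt (T * a * P j) := by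
    apply Finset.sum_le_sum
    intro j _
    exact hpp_abs_J μ T i j a (P j) ha.le (hP j) hI
      (hppJ_int μ i j _ (mul_nonneg ha.le (hP j)) (h j))
  have k3 := mul_le_mul_of_nonneg_left k2 (by positivity : 0 ≤ 4 / (T * a))
  simp only [integral_const, probReal_univ, one_smul]
  linarith

lemma hpp_cond_nonneg (β : ℝ) (πm : ℕ+ → ℕ+ → ℕ+) (i j : ℕ+) : 0 ≤ condP β πm i j := by
  unfold condP
  exact div_nonneg (by positivity) (tsum_nonneg fun _ => by positivity)

lemma hpp_cond_sum (β : ℝ) (hβ1 : 1 < β) (πm : ℕ+ → ℕ+ → ℕ+) (i : ℕ+)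
    (hπ : Function.Bijective (πm i)) : HasSum (condP β πm i) 1 := by
  have hZ := hpp_Z_ge β hβ1
  have h := ((hpp_summable β hβ1).hasSum).div_const (∑' m : ℕ+, ((m : ℕ) : ℝ) ^ (-β))
  rw [div_self (by linarith)] at h
  exact (Equiv.hasSum_iff (Equiv.ofBijective (πm i) hπ)).2 h

/-- embedding of ranks into tokens -/
noncomputable def hppEmb (πm : ℕ+ → ℕ+ → ℕ+) (i : ℕ+) (hπ : Function.Bijective (πm i)) : ℕ ↪ ℕ+ :=
  ⟨fun m => (Equiv.ofBijective (πm i) hπ).symm m.succPNat,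
    (Equiv.injective _).comp Nat.succPNat_injective⟩

lemma hpp_emb_cond (β : ℝ) (πm : ℕ+ → ℕ+ → ℕ+) (i : ℕ+) (hπ : Function.Bijective (πm i)) (m : ℕ) :
    condP β πm i (hppEmb πm i hπ m) =
      ((m : ℝ) + 1) ^ (-β) / ∑' m : ℕ+, ((m : ℕ) : ℝ) ^ (-β) := by
  have : πm i (hppEmb πm i hπ m) = m.succPNat :=
    (Equiv.ofBijective (πm i) hπ).apply_symm_apply m.succPNat
  unfold condP
  rw [this]
  simp

lemma hpp_ceil (y : ℝ) (hy : 1 ≤ y) : (⌈y⌉₊ : ℝ) ≤ 2 * y := by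
  have := Nat.ceil_lt_add_one (by linarith : 0 ≤ y)
  linarith

lemma hpp_upper_ctx (β : ℝ) (hβ1 : 1 < β) (hβ2 : β < 2) (c : ℝ) (hc : c = 1 - 1 / β)
    {T : ℕ} (μ : Measure (ℕ+ × ℕ+)) [IsProbabilityMeasure μ]
    (πm : ℕ+ → ℕ+ → ℕ+) (i : ℕ+) (hπ : Function.Bijective (πm i))
    (a : ℝ) (ha : 0 < a) (hT : 0 < T)
    (h : ∀ j, μ {(i, j)} = ENNReal.ofReal (a * condP β πm i j)) :
    ∫ s : Fin T → ℕ+ × ℕ+, (∑' j, |qEmp s i j - condP β πm i j|)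
      ∂(Measure.pi fun _ : Fin T => μ) ≤
      (10 + 8 / (1 - β / 2) + 2 / (β - 1)) * (T * a) ^ (-c) := by
  have hT' : (0 : ℝ) < T := by exact_mod_cast hT
  have hx : 0 < T * a := by positivity
  have hP := hpp_cond_nonneg β πm i
  have hs := hpp_cond_sum β hβ1 πm i hπ
  have hβ0 : 0 < β := by linarith
  have hc0 : 0 < c := by
    rw [hc, sub_pos, div_lt_one hβ0]; exact hβ1
  have hc1 : c < 1 := by
    have : 0 < 1 / β := by positivity
    linarith
  have p1 : 0 < 1 - β / 2 := by linarith
  have p2 : 0 < β - 1 := by linarith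
  have q1 : 0 < 8 / (1 - β / 2) := by positivity
  have q2 : 0 < 2 / (β - 1) := by positivity
  have hZ := hpp_Z_ge β hβ1
  rcases le_total (T * a) 1 with hx1 | hx1
  · refine (hpp_E_le_two μ i _ hP hs).trans ?_
    have : 1 ≤ (T * a) ^ (-c) := Real.one_le_rpow_of_pos_of_le_one_of_nonpos hx hx1 (by linarith)
    nlinarith
  · set x := T * a with hxdef
    set y := x ^ (1 / β) with hy
    have hy1 : 1 ≤ y := Real.one_le_rpow hx1 (by positivity)
    have hy0 : 0 < y := by linarith
    set M := ⌈y⌉₊ with hM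
    have hM1 : 1 ≤ M := Nat.one_le_ceil_iff.2 hy0
    have hMy : y ≤ M := Nat.le_ceil y
    have hM2 : (M : ℝ) ≤ 2 * y := hpp_ceil y hy1
    have hM0 : (0 : ℝ) < M := by linarith
    refine (hpp_upper μ i a ha hT _ hP hs h ((Finset.range M).map (hppEmb πm i hπ))).trans ?_
    rw [Finset.sum_map, Finset.sum_map, ← hxdef]
    simp_rw [hpp_emb_cond]
    have ht := hpp_tail β hβ1 hβ2 M hM1
    set Z := ∑' m : ℕ+, ((m : ℕ) : ℝ) ^ (-β) with hZdef
    have k1 : 8 / x ≤ 8 * x ^ (-c) := by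
      rw [div_eq_mul_inv, ← Real.rpow_neg_one]
      gcongr
    have k2 : 4 / x * ∑ m ∈ Finset.range M, Real.sqrt (x * (((m : ℝ) + 1) ^ (-β) / Z)) ≤
        8 / (1 - β / 2) * x ^ (-c) := by
      have l1 : ∀ m ∈ Finset.range M, Real.sqrt (x * (((m : ℝ) + 1) ^ (-β) / Z)) ≤
          x ^ (1 / 2 : ℝ) * ((m : ℝ) + 1) ^ (-(β / 2)) := by
        intro m _
        rw [Real.sqrt_mul hx.le, Real.sqrt_eq_rpow x]
        gcongr
        rw [Real.sqrt_le_left (by positivity), ← Real.rpow_mul_natCast (by positivity)]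
        have : -(β / 2) * ((2 : ℕ) : ℝ) = -β := by push_cast; ring
        rw [this]
        exact div_le_self (by positivity) hZ
      have l2 := Finset.sum_le_sum l1
      rw [← Finset.mul_sum] at l2
      have l3 := hpp_head (β / 2) (by linarith) (by linarith) M
      have l4 : (M : ℝ) ^ (1 - β / 2) ≤ 2 * y ^ (1 - β / 2) := by
        calc (M : ℝ) ^ (1 - β / 2) ≤ (2 * y) ^ (1 - β / 2) :=
              Real.rpow_le_rpow hM0.le hM2 p1.le
          _ = 2 ^ (1 - β / 2) * y ^ (1 - β / 2) := Real.mul_rpow (by norm_num) hy0.le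
          _ ≤ 2 * y ^ (1 - β / 2) := by
              gcongr
              calc (2 : ℝ) ^ (1 - β / 2) ≤ 2 ^ (1 : ℝ) :=
                    Real.rpow_le_rpow_of_exponent_le (by norm_num) (by linarith)
                _ = 2 := Real.rpow_one 2
      have l5 : x ^ (-c) = x⁻¹ * (x ^ (1 / 2 : ℝ) * y ^ (1 - β / 2)) := by
        rw [hy, ← Real.rpow_mul hx.le, ← Real.rpow_neg_one, ← Real.rpow_add hx,
          ← Real.rpow_add hx, hc]
        congr 1; field_simp; ring
      calc _ ≤ 4 / x * (x ^ (1 / 2 : ℝ) * ((2 * y ^ (1 - β / 2)) / (1 - β / 2))) := by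
            gcongr
            refine l2.trans ?_
            gcongr
            refine l3.trans ?_
            gcongr
        _ = 8 / (1 - β / 2) * x ^ (-c) := by rw [l5]; ring
    have k3 : 2 * (1 - ∑ m ∈ Finset.range M, ((m : ℝ) + 1) ^ (-β) / Z) ≤
        2 / (β - 1) * x ^ (-c) := by
      rw [← Finset.sum_div]
      have l1 : 1 - (∑ m ∈ Finset.range M, ((m : ℝ) + 1) ^ (-β)) / Z ≤
          (M : ℝ) ^ (1 - β) / (β - 1) := by
        have hZ0 : 0 < Z := by linarith
        rw [one_sub_div hZ0.ne', div_le_iff₀ hZ0]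
        have : 0 ≤ (M : ℝ) ^ (1 - β) / (β - 1) := by positivity
        nlinarith
      have l2 : (M : ℝ) ^ (1 - β) ≤ x ^ (-c) := by
        calc (M : ℝ) ^ (1 - β) ≤ y ^ (1 - β) :=
              Real.rpow_le_rpow_of_nonpos hy0 hMy (by linarith)
          _ = x ^ (-c) := by
              rw [hy, ← Real.rpow_mul hx.le, hc]; congr 1; field_simp; ring
      calc _ ≤ 2 * (x ^ (-c) / (β - 1)) := by
            gcongr
            refine l1.trans ?_
            gcongr
        _ = _ := by ring
    have : 0 < x ^ (-c) := by positivity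
    linarith

lemma hpp_lower_ctx (β : ℝ) (hβ1 : 1 < β) (c : ℝ) (hc : c = 1 - 1 / β)
    {T : ℕ} (μ : Measure (ℕ+ × ℕ+)) [IsProbabilityMeasure μ]
    (πm : ℕ+ → ℕ+ → ℕ+) (i : ℕ+) (hπ : Function.Bijective (πm i))
    (a : ℝ) (ha : 0 ≤ a) (ha1 : a ≤ 1) (hT : 0 < T)
    (h : ∀ j, μ {(i, j)} = ENNReal.ofReal (a * condP β πm i j)) :
    (1 / 2 * (2 : ℝ) ^ (-β) * (2 * 2 ^ (1 / β)) ^ (1 - β) /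
      ∑' m : ℕ+, ((m : ℕ) : ℝ) ^ (-β)) * (T : ℝ) ^ (-c) ≤
    ∫ s : Fin T → ℕ+ × ℕ+, (∑' j, |qEmp s i j - condP β πm i j|)
      ∂(Measure.pi fun _ : Fin T => μ) := by
  have hT' : (0 : ℝ) < T := by exact_mod_cast hT
  have hT1 : (1 : ℝ) ≤ T := by exact_mod_cast hT
  have hP := hpp_cond_nonneg β πm i
  have hs := hpp_cond_sum β hβ1 πm i hπ
  have hβ0 : 0 < β := by linarith
  have hZ := hpp_Z_ge β hβ1
  set y := (2 * (T : ℝ)) ^ (1 / β) with hy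
  have hy1 : 1 ≤ y := Real.one_le_rpow (by linarith) (by positivity)
  have hy0 : 0 < y := by linarith
  set M := ⌈y⌉₊ with hM
  have hMy : y ≤ M := Nat.le_ceil y
  have hM2 : (M : ℝ) ≤ 2 * y := hpp_ceil y hy1
  have hM0 : (0 : ℝ) < M := by linarith
  refine le_trans ?_
    (hpp_lower μ i a ha _ hP hs h ((Finset.Ico M (2 * M)).map (hppEmb πm i hπ)))
  rw [Finset.sum_map]
  simp_rw [hpp_emb_cond]
  set Z := ∑' m : ℕ+, ((m : ℕ) : ℝ) ^ (-β) with hZdef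
  have hZ0 : 0 < Z := by linarith
  have hterm : ∀ m ∈ Finset.Ico M (2 * M), 1 / 2 * ((2 * (M : ℝ)) ^ (-β) / Z) ≤
      ((m : ℝ) + 1) ^ (-β) / Z * (1 - T * (a * (((m : ℝ) + 1) ^ (-β) / Z))) := by
    intro m hm
    rw [Finset.mem_Ico] at hm
    have m1 : (M : ℝ) ≤ m := by exact_mod_cast hm.1
    have m2 : (m : ℝ) + 1 ≤ 2 * M := by exact_mod_cast hm.2
    have g1 : (2 * (M : ℝ)) ^ (-β) ≤ ((m : ℝ) + 1) ^ (-β) :=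
      Real.rpow_le_rpow_of_nonpos (by positivity) m2 (by linarith)
    have g2 : ((m : ℝ) + 1) ^ (-β) ≤ (2 * (T : ℝ))⁻¹ := by
      calc ((m : ℝ) + 1) ^ (-β) ≤ y ^ (-β) :=
            Real.rpow_le_rpow_of_nonpos hy0 (by linarith) (by linarith)
        _ = (2 * (T : ℝ))⁻¹ := by
            rw [hy, ← Real.rpow_mul (by positivity), ← Real.rpow_neg_one]
            congr 1; field_simp
    have g3 : ((m : ℝ) + 1) ^ (-β) / Z ≤ (2 * (T : ℝ))⁻¹ :=
      (div_le_self (by positivity) hZ).trans g2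
    have g4 : 0 ≤ ((m : ℝ) + 1) ^ (-β) / Z := by positivity
    have g5 : T * (a * (((m : ℝ) + 1) ^ (-β) / Z)) ≤ 1 / 2 := by
      calc T * (a * (((m : ℝ) + 1) ^ (-β) / Z)) ≤ T * (1 * (2 * (T : ℝ))⁻¹) := by gcongr
        _ = 1 / 2 := by field_simp
    have g6 : (2 * (M : ℝ)) ^ (-β) / Z ≤ ((m : ℝ) + 1) ^ (-β) / Z := by gcongr
    nlinarith
  refine le_trans ?_ (Finset.sum_le_sum hterm)
  rw [Finset.sum_const, Nat.card_Ico, nsmul_eq_mul]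
  have hcard : ((2 * M - M : ℕ) : ℝ) = M := by congr 1; omega
  rw [hcard]
  have e1 : (M : ℝ) * (1 / 2 * ((2 * (M : ℝ)) ^ (-β) / Z)) =
      1 / 2 * (2 : ℝ) ^ (-β) * (M : ℝ) ^ (1 - β) / Z := by
    rw [Real.mul_rpow (by norm_num) hM0.le, sub_eq_add_neg, Real.rpow_add hM0, Real.rpow_one]
    ring
  have e2 : (2 * y) ^ (1 - β) = (2 * 2 ^ (1 / β)) ^ (1 - β) * (T : ℝ) ^ (-c) := by
    rw [hy, Real.mul_rpow (x := 2) (y := (T : ℝ)) (by norm_num) hT'.le, ← mul_assoc,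
      Real.mul_rpow (by positivity) (by positivity), ← Real.rpow_mul hT'.le, hc]
    congr 2; field_simp; ring
  have e3 : (2 * y) ^ (1 - β) ≤ (M : ℝ) ^ (1 - β) :=
    Real.rpow_le_rpow_of_nonpos hM0 hM2 (by linarith)
  rw [e1]
  calc _ = 1 / 2 * (2 : ℝ) ^ (-β) * (2 * y) ^ (1 - β) / Z := by rw [e2]; ring
    _ ≤ _ := by gcongr

/-- Matching two-sided Hutter++ scaling law: for `β ∈ (1,2)`,
`c = 1 - 1/β`, a distribution `p` with `∑_i p_i^(1-c) < ∞`, and permutations `π_i`,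
the test error of the Hutter++ estimator trained on `T` iid pairs satisfies
`C₁ T^(-c) ≤ E_test(T) ≤ C₂ T^(-c)` for all `T ≥ T₀`, with constants depending only
on `β` and `p`. -/
theorem hutterpp_two_sided (β : ℝ) (hβ1 : 1 < β) (hβ2 : β < 2)
    (c : ℝ) (hc : c = 1 - 1 / β)
    (p : ℕ+ → ℝ) (hp0 : ∀ i, 0 ≤ p i) (hp1 : (∑' i : ℕ+, p i) = 1)
    (hps : Summable fun i : ℕ+ => p i ^ (1 - c)) :
    ∃ C₁ C₂ : ℝ, 0 < C₁ ∧ 0 < C₂ ∧ ∃ T₀ : ℕ,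
      ∀ πm : ℕ+ → ℕ+ → ℕ+, (∀ i, Function.Bijective (πm i)) →
      ∀ μ : Measure (ℕ+ × ℕ+), IsProbabilityMeasure μ →
        (∀ i j : ℕ+, μ {(i, j)} = ENNReal.ofReal (p i * condP β πm i j)) →
      ∀ T : ℕ, T₀ ≤ T →
        C₁ * (T : ℝ) ^ (-c) ≤ EtestBigram p (condP β πm) μ T ∧
        EtestBigram p (condP β πm) μ T ≤ C₂ * (T : ℝ) ^ (-c) := by
  have hps1 : Summable p := by
    by_contra hn
    rw [tsum_eq_zero_of_not_summable hn] at hp1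
    norm_num at hp1
  have hple : ∀ i, p i ≤ 1 := fun i => by
    rw [← hp1]; exact hps1.le_tsum i (fun j _ => hp0 j)
  have hZ := hpp_Z_ge β hβ1
  have p1 : 0 < 1 - β / 2 := by linarith
  have p2 : 0 < β - 1 := by linarith
  have hS : 0 ≤ ∑' i, p i ^ (1 - c) := tsum_nonneg fun i => Real.rpow_nonneg (hp0 i) _
  refine ⟨1 / 2 * (2 : ℝ) ^ (-β) * (2 * 2 ^ (1 / β)) ^ (1 - β) /
      ∑' m : ℕ+, ((m : ℕ) : ℝ) ^ (-β),
    (10 + 8 / (1 - β / 2) + 2 / (β - 1)) * (∑' i, p i ^ (1 - c)) + 1, by positivity,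
    by positivity, 1, ?_⟩
  intro πm hπ μ hμ hμp T hT
  have hT0 : 0 < T := hT
  have hT' : (0 : ℝ) < T := by exact_mod_cast hT0
  unfold EtestBigram
  have hsum : Summable fun i : ℕ+ => p i *
      ∫ s : Fin T → ℕ+ × ℕ+, (∑' j : ℕ+, |qEmp s i j - condP β πm i j|)
        ∂(Measure.pi fun _ : Fin T => μ) := by
    apply Summable.of_nonneg_of_le (fun i => mul_nonneg (hp0 i) (hpp_E_nonneg μ i _))
      (fun i => mul_le_mul_of_nonneg_left (hpp_E_le_two μ i _ (hpp_cond_nonneg β πm i)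
        (hpp_cond_sum β hβ1 πm i (hπ i))) (hp0 i)) (hps1.mul_right 2)
  constructor
  · generalize hK : 1 / 2 * (2 : ℝ) ^ (-β) * (2 * 2 ^ (1 / β)) ^ (1 - β) /
      ∑' m : ℕ+, ((m : ℕ) : ℝ) ^ (-β) = K
    have e : K * (T : ℝ) ^ (-c) = ∑' i, p i * (K * (T : ℝ) ^ (-c)) := by
      rw [tsum_mul_right, hp1, one_mul]
    rw [e]
    apply Summable.tsum_le_tsum _ (hps1.mul_right _) hsum
    intro i
    apply mul_le_mul_of_nonneg_left _ (hp0 i)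
    rw [← hK]
    exact hpp_lower_ctx β hβ1 c hc μ πm i (hπ i) (p i) (hp0 i) (hple i) hT0 (hμp i)
  · generalize hK : 10 + 8 / (1 - β / 2) + 2 / (β - 1) = K
    have hTc : 0 ≤ (T : ℝ) ^ (-c) := by positivity
    calc _ ≤ ∑' i, (K * (T : ℝ) ^ (-c)) * p i ^ (1 - c) := by
          apply Summable.tsum_le_tsum _ hsum (hps.mul_left _)
          intro i
          rcases (hp0 i).eq_or_lt with h0 | h0
          · rw [← h0, zero_mul]
            have hK0 : 0 ≤ K := by rw [← hK]; positivity
            positivity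
          · have := hpp_upper_ctx β hβ1 hβ2 c hc μ πm i (hπ i) (p i) h0 hT0 (hμp i)
            rw [hK, Real.mul_rpow hT'.le h0.le] at this
            have e : p i ^ (1 - c) = p i * p i ^ (-c) := by
              rw [sub_eq_add_neg, Real.rpow_add h0, Real.rpow_one]
            rw [e]
            calc _ ≤ p i * (K * ((T : ℝ) ^ (-c) * p i ^ (-c))) :=
                  mul_le_mul_of_nonneg_left this (hp0 i)
              _ = _ := by ring
      _ = (K * ∑' i, p i ^ (1 - c)) * (T : ℝ) ^ (-c) := by rw [tsum_mul_left]; ring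
      _ ≤ _ := by
          apply mul_le_mul_of_nonneg_right _ hTc
          linarith
end
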